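/- Let $V$ be a separable Hilbert space, $p\in[2,\infty)$, $-\infty\le a<b\le\infty$, and let $f:(a,b)\times\mathbb{R}^d\to V$ be infinitely differentiable with compact support. Then $\int_{\mathbb{R}^d}\int_a^b\left[\int_a^t\|\nabla T_{t-s}f(s,\cdot)(x)\|^2\,ds\right]^{p/2}dt\,dx\;\le\;N\int_{\mathbb{R}^d}\int_a^b\|f(t,x)\|_V^p\,dt\,dx,$ where $N$ is a constant depending only on $d$ and $p$. -/

import Mathlib

open MeasureTheory ENNReal

/-- The heat kernel `G_t(x) = (4πt)^{-d/2} exp(-|x|²/(4t))` on `ℝ^d`. -/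
noncomputable def heatKernel (d : ℕ) (t : ℝ) (x : EuclideanSpace ℝ (Fin d)) : ℝ :=
  (4 * Real.pi * t) ^ (-(d : ℝ)/2) * Real.exp (-‖x‖^2 / (4*t))

/-- The heat semigroup `T_t h (x) = ∫_{ℝ^d} h(x-y) G_t(y) dy` (Bochner integral). -/
noncomputable def heatOp (d : ℕ) {V : Type*} [NormedAddCommGroup V] [NormedSpace ℝ V]
    [CompleteSpace V] (t : ℝ) (h : EuclideanSpace ℝ (Fin d) → V)
    (x : EuclideanSpace ℝ (Fin d)) : V :=
  ∫ y, heatKernel d t y • h (x - y)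

/-- Squared norm of the spatial gradient of `T_t h` at `x`:
`‖∇ T_t h(x)‖² = ∑_{j=1}^d ‖∂_{x_j} T_t h(x)‖²`. -/
noncomputable def gradHeatNormSq (d : ℕ) {V : Type*} [NormedAddCommGroup V]
    [NormedSpace ℝ V] [CompleteSpace V] (t : ℝ) (h : EuclideanSpace ℝ (Fin d) → V)
    (x : EuclideanSpace ℝ (Fin d)) : ℝ :=
  ∑ j : Fin d, ‖fderiv ℝ (heatOp d t h) x (EuclideanSpace.single j 1)‖^2

section HeatMeasure

variable {d : ℕ}

/-- The Gaussian measure on `ℝ^d` with density the heat kernel at time `t`. -/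
noncomputable def heatMeasure (d : ℕ) (t : ℝ) : Measure (EuclideanSpace ℝ (Fin d)) :=
  volume.withDensity (fun y => ENNReal.ofReal (heatKernel d t y))

lemma heatKernel_nonneg {t : ℝ} (ht : 0 < t) (y : EuclideanSpace ℝ (Fin d)) :
    0 ≤ heatKernel d t y := by
  unfold heatKernel; positivity

lemma continuous_heatKernel (t : ℝ) : Continuous (heatKernel d t) := by
  unfold heatKernel; fun_prop

lemma integrable_heatKernel {t : ℝ} (ht : 0 < t) : Integrable (heatKernel d t) := by
  have h := GaussianFourier.integrable_cexp_neg_mul_sq_norm_add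
    (V := EuclideanSpace ℝ (Fin d)) (b := ((1 / (4 * t) : ℝ) : ℂ))
    (by rw [Complex.ofReal_re]; positivity) 0 0
  have h2 := h.norm.const_mul ((4 * Real.pi * t) ^ (-(d : ℝ)/2))
  refine h2.congr (Filter.Eventually.of_forall fun y => ?_)
  simp only [heatKernel, Complex.norm_exp]
  congr 2
  simp [← Complex.ofReal_pow]
  ring_nf

lemma integral_heatKernel {t : ℝ} (ht : 0 < t) : ∫ y, heatKernel d t y = 1 := by
  have h := GaussianFourier.integral_rexp_neg_mul_sq_norm
    (V := EuclideanSpace ℝ (Fin d)) (b := 1 / (4 * t)) (by positivity)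
  have h2 : ∀ y : EuclideanSpace ℝ (Fin d), heatKernel d t y =
      (4 * Real.pi * t) ^ (-(d : ℝ)/2) * Real.exp (-(1 / (4 * t)) * ‖y‖ ^ 2) := by
    intro y; unfold heatKernel; congr 2; ring
  simp_rw [h2]
  rw [integral_const_mul, h, finrank_euclideanSpace_fin, neg_div, Real.rpow_neg (by positivity)]
  have : Real.pi / (1 / (4 * t)) = 4 * Real.pi * t := by field_simp
  rw [this]
  exact inv_mul_cancel₀ (by positivity)

lemma isProbabilityMeasure_heatMeasure {t : ℝ} (ht : 0 < t) :
    IsProbabilityMeasure (heatMeasure d t) := by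
  constructor
  rw [heatMeasure, withDensity_apply _ MeasurableSet.univ, Measure.restrict_univ,
    ← ofReal_integral_eq_lintegral_ofReal (integrable_heatKernel ht)
      (Filter.Eventually.of_forall (heatKernel_nonneg ht)), integral_heatKernel ht]
  simp

lemma integral_heatMeasure {V : Type*} [NormedAddCommGroup V] [NormedSpace ℝ V]
    {t : ℝ} (ht : 0 < t) (g : EuclideanSpace ℝ (Fin d) → V) :
    ∫ y, g y ∂(heatMeasure d t) = ∫ y, heatKernel d t y • g y := by
  rw [heatMeasure, integral_withDensity_eq_integral_toReal_smul]
  · simp [ENNReal.toReal_ofReal (heatKernel_nonneg ht _)]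
  · exact (continuous_heatKernel t).measurable.ennreal_ofReal
  · simp

lemma lintegral_heatMeasure {t : ℝ} {g : EuclideanSpace ℝ (Fin d) → ℝ≥0∞} (hg : Measurable g) :
    ∫⁻ y, g y ∂(heatMeasure d t) = ∫⁻ y, ENNReal.ofReal (heatKernel d t y) * g y := by
  rw [heatMeasure, lintegral_withDensity_eq_lintegral_mul _
    (continuous_heatKernel t).measurable.ennreal_ofReal hg]
  rfl

lemma heatOp_eq_integral {V : Type*} [NormedAddCommGroup V] [NormedSpace ℝ V] [CompleteSpace V]
    {t : ℝ} (ht : 0 < t) (h : EuclideanSpace ℝ (Fin d) → V) (x : EuclideanSpace ℝ (Fin d)) :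
    heatOp d t h x = ∫ y, h (x - y) ∂(heatMeasure d t) := by
  rw [integral_heatMeasure ht]; rfl

lemma charFun_heatMeasure {t : ℝ} (ht : 0 < t) (ξ : EuclideanSpace ℝ (Fin d)) :
    charFun (heatMeasure d t) ξ = Complex.exp (-(t * ‖ξ‖ ^ 2 : ℝ)) := by
  obtain ⟨K, hK⟩ : ∃ K : ℂ, ∀ ξ : EuclideanSpace ℝ (Fin d),
      charFun (heatMeasure d t) ξ = K * Complex.exp (-(t * ‖ξ‖ ^ 2 : ℝ)) := by
    refine ⟨((4 * Real.pi * t) ^ (-(d : ℝ)/2) : ℝ) * ((Real.pi / ((1 / (4 * t) : ℝ) : ℂ)) ^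
      (Module.finrank ℝ (EuclideanSpace ℝ (Fin d)) / 2 : ℂ)), fun ξ => ?_⟩
    have h := GaussianFourier.integral_cexp_neg_mul_sq_norm_add
      (V := EuclideanSpace ℝ (Fin d)) (b := ((1 / (4 * t) : ℝ) : ℂ))
      (by rw [Complex.ofReal_re]; positivity) Complex.I ξ
    rw [charFun_apply, integral_heatMeasure ht]
    have h2 : ∀ y : EuclideanSpace ℝ (Fin d),
        heatKernel d t y • Complex.exp (inner ℝ y ξ * Complex.I) =
        (((4 * Real.pi * t) ^ (-(d : ℝ)/2) : ℝ) : ℂ) *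
          Complex.exp (-((1 / (4 * t) : ℝ) : ℂ) * ‖y‖ ^ 2 + Complex.I * inner ℝ ξ y) := by
      intro y
      rw [Complex.exp_add, heatKernel, Complex.real_smul, Complex.ofReal_mul, Complex.ofReal_exp,
        real_inner_comm, mul_comm Complex.I, mul_assoc]
      congr 3
      push_cast
      ring_nf
    simp_rw [h2]
    rw [integral_const_mul, h, ← mul_assoc]
    congr 2
    have : (t : ℂ) ≠ 0 := by exact_mod_cast ht.ne'
    push_cast
    rw [Complex.I_sq]
    field_simp
  have := isProbabilityMeasure_heatMeasure (d := d) ht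
  have h0 := hK 0
  simp at h0
  rw [hK, ← h0, one_mul]

lemma heatMeasure_conv {a b : ℝ} (ha : 0 < a) (hb : 0 < b) :
    Measure.conv (heatMeasure d a) (heatMeasure d b) = heatMeasure d (a + b) := by
  have := isProbabilityMeasure_heatMeasure (d := d) ha
  have := isProbabilityMeasure_heatMeasure (d := d) hb
  have := isProbabilityMeasure_heatMeasure (d := d) (add_pos ha hb)
  apply Measure.ext_of_charFun
  ext ξ
  rw [charFun_conv, charFun_heatMeasure ha, charFun_heatMeasure hb,
    charFun_heatMeasure (add_pos ha hb), ← Complex.exp_add]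
  congr 1
  push_cast
  ring

lemma lintegral_comp_neg_heatMeasure (t : ℝ) {F : EuclideanSpace ℝ (Fin d) → ℝ≥0∞}
    (hF : Measurable F) :
    ∫⁻ y, F (-y) ∂(heatMeasure d t) = ∫⁻ y, F y ∂(heatMeasure d t) := by
  rw [lintegral_heatMeasure hF, lintegral_heatMeasure (g := fun y => F (-y)) (hF.comp measurable_neg),
    ← lintegral_neg_eq_self]
  simp [heatKernel]

lemma heatKernel_le_mul {a b c : ℝ} (hc : 1 ≤ c) (ha : 0 < a) (hab : a ≤ b) (hb : b ≤ c * a)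
    (y : EuclideanSpace ℝ (Fin d)) :
    heatKernel d a y ≤ c ^ ((d : ℝ)/2) * heatKernel d b y := by
  have hc0 : 0 < c := by linarith
  have hb0 : 0 < b := by linarith
  unfold heatKernel
  rw [← mul_assoc]
  refine mul_le_mul ?_ ?_ (by positivity) (by positivity)
  · rw [neg_div, Real.rpow_neg (by positivity), Real.rpow_neg (by positivity),
      ← div_eq_mul_inv, le_div_iff₀ (by positivity), inv_mul_le_iff₀ (by positivity),
      ← Real.mul_rpow (by positivity) (by positivity)]
    apply Real.rpow_le_rpow (by positivity) _ (by positivity)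
    nlinarith [Real.pi_pos]
  · apply Real.exp_le_exp.mpr
    rw [neg_div, neg_div, neg_le_neg_iff]
    gcongr

lemma lintegral_heatMeasure_le {a b c : ℝ} (hc : 1 ≤ c) (ha : 0 < a) (hab : a ≤ b)
    (hb : b ≤ c * a) {F : EuclideanSpace ℝ (Fin d) → ℝ≥0∞} (hF : Measurable F) :
    ∫⁻ y, F y ∂(heatMeasure d a) ≤
      ENNReal.ofReal (c ^ ((d : ℝ)/2)) * ∫⁻ y, F y ∂(heatMeasure d b) := by
  rw [lintegral_heatMeasure hF, lintegral_heatMeasure hF, ← lintegral_const_mul']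
  · refine lintegral_mono fun y => ?_
    rw [← mul_assoc, ← ENNReal.ofReal_mul (by positivity)]
    gcongr
    exact heatKernel_le_mul hc ha hab hb y
  · simp

lemma lintegral_lintegral_heatMeasure {t : ℝ} (ht : 0 < t)
    {F : EuclideanSpace ℝ (Fin d) → ℝ≥0∞} (hF : Measurable F) :
    ∫⁻ x, ∫⁻ y, F (x - y) ∂(heatMeasure d t) = ∫⁻ x, F x := by
  have := isProbabilityMeasure_heatMeasure (d := d) ht
  rw [lintegral_lintegral_swap (by fun_prop)]
  simp_rw [lintegral_sub_right_eq_self]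
  simp

end HeatMeasure

section HeatOp

variable {d : ℕ} {V : Type*} [NormedAddCommGroup V] [NormedSpace ℝ V] [CompleteSpace V]

lemma norm_heatOp_le {t C : ℝ} (ht : 0 < t) {g : EuclideanSpace ℝ (Fin d) → V}
    (hC : ∀ y, ‖g y‖ ≤ C) (x : EuclideanSpace ℝ (Fin d)) : ‖heatOp d t g x‖ ≤ C := by
  have := isProbabilityMeasure_heatMeasure (d := d) ht
  rw [heatOp_eq_integral ht]
  simpa using norm_integral_le_of_norm_le_const (μ := heatMeasure d t)
    (Filter.Eventually.of_forall fun y => hC (x - y))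

lemma stronglyMeasurable_heatOp {t : ℝ} {g : EuclideanSpace ℝ (Fin d) → V}
    (hg : StronglyMeasurable g) : StronglyMeasurable (heatOp d t g) := by
  unfold heatOp
  refine StronglyMeasurable.integral_prod_right (f := fun x y => heatKernel d t y • g (x - y)) ?_
  exact ((continuous_heatKernel t).comp continuous_snd).stronglyMeasurable.smul
    (hg.comp_measurable (measurable_fst.sub measurable_snd))

omit [NormedSpace ℝ V] [CompleteSpace V] in
lemma integrable_heatMeasure_of_bounded {t C : ℝ} (ht : 0 < t)
    {g : EuclideanSpace ℝ (Fin d) → V} (hg : StronglyMeasurable g) (hC : ∀ y, ‖g y‖ ≤ C) :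
    Integrable g (heatMeasure d t) := by
  have := isProbabilityMeasure_heatMeasure (d := d) ht
  exact Integrable.of_bound hg.aestronglyMeasurable C (Filter.Eventually.of_forall hC)

lemma heatOp_heatOp {a b C : ℝ} (ha : 0 < a) (hb : 0 < b) {g : EuclideanSpace ℝ (Fin d) → V}
    (hg : StronglyMeasurable g) (hC : ∀ y, ‖g y‖ ≤ C) (x : EuclideanSpace ℝ (Fin d)) :
    heatOp d a (heatOp d b g) x = heatOp d (a + b) g x := by
  have := isProbabilityMeasure_heatMeasure (d := d) ha
  have := isProbabilityMeasure_heatMeasure (d := d) hb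
  rw [heatOp_eq_integral ha, heatOp_eq_integral (add_pos ha hb), ← heatMeasure_conv ha hb,
    integral_conv]
  · simp_rw [heatOp_eq_integral hb, sub_add_eq_sub_sub]
  · rw [heatMeasure_conv ha hb]
    exact integrable_heatMeasure_of_bounded (add_pos ha hb)
      (hg.comp_measurable (measurable_const.sub measurable_id)) (fun y => hC _)

lemma heatOp_eq_convolution (t : ℝ) (g : EuclideanSpace ℝ (Fin d) → V) :
    heatOp d t g = convolution (heatKernel d t) g (ContinuousLinearMap.lsmul ℝ ℝ) volume := by
  ext x
  simp [heatOp, convolution]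

lemma contDiff_heatOp {t : ℝ} (ht : 0 < t) {g : EuclideanSpace ℝ (Fin d) → V}
    (hg : ContDiff ℝ 1 g) (hgc : HasCompactSupport g) : ContDiff ℝ 1 (heatOp d t g) := by
  rw [heatOp_eq_convolution]
  exact_mod_cast hgc.contDiff_convolution_right (n := 1) _
    (integrable_heatKernel ht).locallyIntegrable hg

lemma fderiv_heatOp {t : ℝ} (ht : 0 < t) {g : EuclideanSpace ℝ (Fin d) → V}
    (hg : ContDiff ℝ 1 g) (hgc : HasCompactSupport g) (x e : EuclideanSpace ℝ (Fin d)) :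
    fderiv ℝ (heatOp d t g) x e = heatOp d t (fun y => fderiv ℝ g y e) x := by
  rw [heatOp_eq_convolution, (hgc.hasFDerivAt_convolution_right _
    (integrable_heatKernel ht).locallyIntegrable hg x).fderiv]
  have hi : Integrable (fun y => heatKernel d t y • fderiv ℝ g (x - y)) := by
    obtain ⟨C, hC⟩ := (hgc.fderiv (𝕜 := ℝ)).exists_bound_of_continuous
      (hg.continuous_fderiv one_ne_zero)
    refine (integrable_heatKernel ht).smul_bdd C ?_ (Filter.Eventually.of_forall fun y => hC _)
    exact ((hg.continuous_fderiv one_ne_zero).comp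
      (continuous_const.sub continuous_id)).aestronglyMeasurable
  have : (convolution (heatKernel d t) (fderiv ℝ g)
      ((ContinuousLinearMap.lsmul ℝ ℝ).precompR (EuclideanSpace ℝ (Fin d))) volume) x =
      ∫ y, heatKernel d t y • fderiv ℝ g (x - y) := by
    unfold convolution
    congr 1
  rw [this, ContinuousLinearMap.integral_apply hi]
  rfl

lemma enorm_heatOp_sq_le {t : ℝ} (ht : 0 < t) {g : EuclideanSpace ℝ (Fin d) → V}
    (hg : StronglyMeasurable g) (x : EuclideanSpace ℝ (Fin d)) :
    ‖heatOp d t g x‖ₑ ^ 2 ≤ ∫⁻ y, ‖g (x - y)‖ₑ ^ 2 ∂(heatMeasure d t) := by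
  have := isProbabilityMeasure_heatMeasure (d := d) ht
  have h1 : ‖heatOp d t g x‖ₑ ≤ ∫⁻ y, ‖g (x - y)‖ₑ ∂(heatMeasure d t) := by
    rw [heatOp_eq_integral ht]
    exact enorm_integral_le_lintegral_enorm _
  have hm : AEMeasurable (fun y => ‖g (x - y)‖ₑ) (heatMeasure d t) :=
    (hg.comp_measurable (measurable_const.sub measurable_id)).enorm.aemeasurable
  have h2 := ENNReal.lintegral_mul_le_Lp_mul_Lq (heatMeasure d t) Real.HolderConjugate.two_two
    hm (aemeasurable_const (b := (1 : ℝ≥0∞)))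
  simp only [Pi.mul_apply, mul_one, one_rpow, lintegral_const, measure_univ] at h2
  calc _ ≤ ((∫⁻ y, ‖g (x - y)‖ₑ ^ (2 : ℝ) ∂(heatMeasure d t)) ^ (1 / 2 : ℝ)) ^ 2 := by
        gcongr; exact h1.trans h2
    _ = _ := by
        rw [← ENNReal.rpow_natCast, ← ENNReal.rpow_mul]
        norm_num

lemma hasFDerivAt_heatKernel {t : ℝ} (y : EuclideanSpace ℝ (Fin d)) :
    HasFDerivAt (heatKernel d t) (-(heatKernel d t y / (2 * t)) • innerSL ℝ y) y := by
  have h1 : HasFDerivAt (fun y : EuclideanSpace ℝ (Fin d) => ‖y‖ ^ 2) (2 • innerSL ℝ y) y :=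
    (hasStrictFDerivAt_norm_sq y).hasFDerivAt
  have h2 := ((h1.neg.mul_const (4 * t)⁻¹).exp).const_mul ((4 * Real.pi * t) ^ (-(d : ℝ)/2))
  simp only [← div_eq_mul_inv] at h2
  unfold heatKernel
  refine h2.congr_fderiv ?_
  ext v
  simp
  ring

lemma heatKernel_mul_sq_le {t : ℝ} (ht : 0 < t) (y : EuclideanSpace ℝ (Fin d)) :
    heatKernel d t y * ‖y‖ ^ 2 ≤ 8 * t * 2 ^ ((d : ℝ)/2) * heatKernel d (2 * t) y := by
  have h1 := Real.add_one_le_exp (‖y‖ ^ 2 / (8 * t))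
  have h2 : ‖y‖ ^ 2 ≤ 8 * t * Real.exp (‖y‖ ^ 2 / (8 * t)) := by
    rw [← div_le_iff₀' (by positivity)]; linarith
  have h3 : Real.exp (-‖y‖ ^ 2 / (4 * t)) * Real.exp (‖y‖ ^ 2 / (8 * t)) =
      Real.exp (-‖y‖ ^ 2 / (4 * (2 * t))) := by
    rw [← Real.exp_add]; congr 1; field_simp; ring
  have h4 : (4 * Real.pi * t) ^ (-(d : ℝ)/2) =
      2 ^ ((d : ℝ)/2) * (4 * Real.pi * (2 * t)) ^ (-(d : ℝ)/2) := by
    rw [show 4 * Real.pi * (2 * t) = 2 * (4 * Real.pi * t) by ring,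
      Real.mul_rpow (x := 2) (by positivity) (by positivity), ← mul_assoc,
      ← Real.rpow_add (by positivity)]
    simp [neg_div]
  calc _ ≤ heatKernel d t y * (8 * t * Real.exp (‖y‖ ^ 2 / (8 * t))) := by
        gcongr; exact heatKernel_nonneg ht y
    _ = _ := by
        unfold heatKernel
        rw [← h3, h4]
        ring

lemma lintegral_inner_sq_heatMeasure_le {t : ℝ} (ht : 0 < t) {e : EuclideanSpace ℝ (Fin d)}
    (he : ‖e‖ ≤ 1) :
    ∫⁻ y, ‖inner ℝ y e / (2 * t)‖ₑ ^ 2 ∂(heatMeasure d t) ≤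
      ENNReal.ofReal (2 * 2 ^ ((d : ℝ)/2) / t) := by
  rw [lintegral_heatMeasure (by fun_prop)]
  have h2t : 0 < 2 * t := by positivity
  calc _ ≤ ∫⁻ y, ENNReal.ofReal (2 * 2 ^ ((d : ℝ)/2) / t * heatKernel d (2 * t) y) := by
        refine lintegral_mono fun y => ?_
        rw [← ofReal_norm, ← ENNReal.ofReal_pow (norm_nonneg _),
          ← ENNReal.ofReal_mul (heatKernel_nonneg ht y)]
        apply ENNReal.ofReal_le_ofReal
        have h1 : |inner ℝ y e| ≤ ‖y‖ := (abs_real_inner_le_norm y e).trans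
          (mul_le_of_le_one_right (norm_nonneg _) he)
        have h2 : ‖inner ℝ y e / (2 * t)‖ ^ 2 ≤ ‖y‖ ^ 2 / (4 * t ^ 2) := by
          rw [Real.norm_eq_abs, abs_div, abs_of_pos h2t, div_pow,
            show (2 * t) ^ 2 = 4 * t ^ 2 by ring]
          gcongr
        calc _ ≤ heatKernel d t y * (‖y‖ ^ 2 / (4 * t ^ 2)) := by
              gcongr; exact heatKernel_nonneg ht y
          _ = heatKernel d t y * ‖y‖ ^ 2 / (4 * t ^ 2) := by ring
          _ ≤ (8 * t * 2 ^ ((d : ℝ)/2) * heatKernel d (2 * t) y) / (4 * t ^ 2) := by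
              exact div_le_div_of_nonneg_right (heatKernel_mul_sq_le ht y) (by positivity)
          _ = _ := by field_simp; ring
    _ = _ := by
        simp_rw [ENNReal.ofReal_mul (show 0 ≤ 2 * 2 ^ ((d : ℝ)/2) / t by positivity)]
        rw [lintegral_const_mul _ (continuous_heatKernel _).measurable.ennreal_ofReal,
          ← ofReal_integral_eq_lintegral_ofReal (integrable_heatKernel h2t)
          (Filter.Eventually.of_forall (heatKernel_nonneg h2t)), integral_heatKernel h2t]
        simp

/-- The gradient of the heat semigroup is controlled by the local oscillation (a reverse
Poincaré inequality). -/
lemma enorm_heatOp_fderiv_sq_le {t C C' : ℝ} (ht : 0 < t) {u : EuclideanSpace ℝ (Fin d) → V}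
    {e : EuclideanSpace ℝ (Fin d)} (he : ‖e‖ ≤ 1) (hu : ContDiff ℝ 1 u) (hC : ∀ y, ‖u y‖ ≤ C)
    (hC' : ∀ y, ‖fderiv ℝ u y e‖ ≤ C') (x : EuclideanSpace ℝ (Fin d)) (c : V) :
    ‖heatOp d t (fun y => fderiv ℝ u y e) x‖ₑ ^ 2 ≤
      ENNReal.ofReal (2 * 2 ^ ((d : ℝ)/2) / t) *
        ∫⁻ y, ‖u (x - y) - c‖ₑ ^ 2 ∂(heatMeasure d t) := by
  have hcu : Continuous (fun y => u (x - y) - c) := by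
    have := hu.continuous; fun_prop
  have hb : ∀ y, ‖u (x - y) - c‖ ≤ C + ‖c‖ := fun y => (norm_sub_le _ _).trans (by grw [hC])
  have hcd : Continuous (fun y => fderiv ℝ u (x - y) e) := by
    have := hu.continuous_fderiv one_ne_zero; fun_prop
  have hfd : ∀ y, HasFDerivAt (fun y => u (x - y) - c) (-(fderiv ℝ u (x - y))) y := by
    intro y
    have h1 : HasFDerivAt u (fderiv ℝ u (x - y)) (x - y) :=
      (hu.differentiable one_ne_zero _).hasFDerivAt
    have h2 := (h1.comp y ((hasFDerivAt_id y).const_sub x)).sub_const c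
    refine h2.congr_fderiv ?_
    ext v; simp
  have hint : Integrable (fun y => heatKernel d t y * (inner ℝ y e / (2 * t))) := by
    have h2t : 0 < 2 * t := by positivity
    refine Integrable.mono' (((integrable_heatKernel ht).add ((integrable_heatKernel h2t).const_mul
      (8 * t * 2 ^ ((d : ℝ)/2)))).div_const (2 * t))
      ((continuous_heatKernel t).mul (by fun_prop)).aestronglyMeasurable
      (Filter.Eventually.of_forall fun y => ?_)
    have h0 := heatKernel_nonneg ht y
    have h1 : |inner ℝ y e| ≤ ‖y‖ := (abs_real_inner_le_norm y e).trans
      (mul_le_of_le_one_right (norm_nonneg _) he)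
    have h3 := heatKernel_mul_sq_le ht y
    rw [Real.norm_eq_abs, abs_mul, abs_div, abs_of_pos h2t, abs_of_nonneg h0, ← mul_div_assoc]
    simp only [Pi.add_apply]
    gcongr
    calc _ ≤ heatKernel d t y * (1 + ‖y‖ ^ 2) := by
          gcongr; nlinarith [norm_nonneg y, sq_nonneg (‖y‖ - 1)]
      _ ≤ _ := by linarith
  have key : heatOp d t (fun y => fderiv ℝ u y e) x =
      ∫ y, (-(inner ℝ y e / (2 * t))) • (u (x - y) - c) ∂(heatMeasure d t) := by
    rw [integral_heatMeasure ht]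
    have h := integral_bilinear_hasFDerivAt_right_eq_neg_left_of_integrable
      (μ := (volume : Measure (EuclideanSpace ℝ (Fin d))))
      (f := heatKernel d t) (g := fun y => u (x - y) - c) (v := e)
      (B := ContinuousLinearMap.lsmul ℝ ℝ)
      (f' := fun y => -(heatKernel d t y / (2 * t)) • innerSL ℝ y)
      (g' := fun y => -(fderiv ℝ u (x - y))) ?_ ?_ ?_ (fun y _ => hasFDerivAt_heatKernel y)
      (fun y _ => hfd y)
    · simp only [ContinuousLinearMap.lsmul_apply, neg_apply, smul_neg,
        integral_neg, smul_apply, innerSL_apply_apply, smul_eq_mul,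
        neg_smul, neg_neg] at h
      rw [neg_eq_iff_eq_neg, ← integral_neg] at h
      rw [heatOp, h]
      congr 1
      ext y
      rw [smul_smul, ← neg_smul]
      congr 1
      ring
    · have := (hint.neg).smul_bdd (C + ‖c‖) hcu.aestronglyMeasurable
        (Filter.Eventually.of_forall hb)
      refine this.congr (Filter.Eventually.of_forall fun y => ?_)
      simp only [Pi.smul_apply', Pi.neg_apply, ContinuousLinearMap.lsmul_apply, smul_apply,
        innerSL_apply_apply, smul_eq_mul]
      congr 1
      ring
    · refine (integrable_heatKernel ht).smul_bdd C' ?_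
        (Filter.Eventually.of_forall fun y => ?_)
      · exact hcd.neg.aestronglyMeasurable
      · simpa using hC' _
    · exact (integrable_heatKernel ht).smul_bdd (C + ‖c‖) hcu.aestronglyMeasurable
        (Filter.Eventually.of_forall hb)
  have h1 : ‖heatOp d t (fun y => fderiv ℝ u y e) x‖ₑ ≤
      ∫⁻ y, ‖inner ℝ y e / (2 * t)‖ₑ * ‖u (x - y) - c‖ₑ ∂(heatMeasure d t) := by
    rw [key]
    refine (enorm_integral_le_lintegral_enorm _).trans (le_of_eq ?_)
    simp_rw [enorm_smul, enorm_neg]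
  have h2 := ENNReal.lintegral_mul_le_Lp_mul_Lq (heatMeasure d t) Real.HolderConjugate.two_two
    (f := fun y => ‖inner ℝ y e / (2 * t)‖ₑ) (g := fun y => ‖u (x - y) - c‖ₑ)
    (by fun_prop) hcu.enorm.aemeasurable
  have h3 : ∀ a : ℝ≥0∞, (a ^ (1 / 2 : ℝ)) ^ 2 = a := fun a => by
    rw [← ENNReal.rpow_natCast, ← ENNReal.rpow_mul]; norm_num
  simp only [Pi.mul_apply, ENNReal.rpow_two] at h2
  calc _ ≤ _ := pow_le_pow_left₀ zero_le (h1.trans h2) 2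
    _ = _ := by rw [mul_pow, h3, h3]
    _ ≤ _ := by gcongr; exact lintegral_inner_sq_heatMeasure_le ht he

end HeatOp

section ForwardMaximal

/-- The one-sided maximal function over forward intervals with lengths `ρ k`. -/
noncomputable def forwardMax (ρ : ℤ → ℝ) (ψ : ℝ → ℝ≥0∞) (s : ℝ) : ℝ≥0∞ :=
  ⨆ k : ℤ, (ENNReal.ofReal (ρ k))⁻¹ * ∫⁻ t in Set.Icc s (s + ρ k), ψ t

variable {ρ : ℤ → ℝ}

lemma forwardMax_le_of_le (hρ : ∀ k, 0 < ρ k) {ψ : ℝ → ℝ≥0∞} {m : ℝ≥0∞} (hm : ∀ t, ψ t ≤ m)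
    (s : ℝ) : forwardMax ρ ψ s ≤ m := by
  refine iSup_le fun k => ?_
  have h0 : ENNReal.ofReal (ρ k) ≠ 0 := by simpa using hρ k
  calc _ ≤ (ENNReal.ofReal (ρ k))⁻¹ * ∫⁻ t in Set.Icc s (s + ρ k), m := by
        gcongr; exact hm _
    _ = m := by
        rw [setLIntegral_const, Real.volume_Icc, add_sub_cancel_left, mul_comm m, ← mul_assoc,
          ENNReal.inv_mul_cancel h0 ENNReal.ofReal_ne_top, one_mul]

lemma measurable_forwardMax_uncurry {α : Type*} [MeasurableSpace α] {φ : ℝ → α → ℝ≥0∞}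
    (hφ : Measurable (Function.uncurry φ)) :
    Measurable (fun p : ℝ × α => forwardMax ρ (fun t => φ t p.2) p.1) := by
  refine Measurable.iSup fun k => Measurable.const_mul ?_ _
  have h : ∀ p : ℝ × α, ∫⁻ t in Set.Icc p.1 (p.1 + ρ k), φ t p.2 =
      ∫⁻ t, {z : (ℝ × α) × ℝ | z.1.1 ≤ z.2 ∧ z.2 ≤ z.1.1 + ρ k}.indicator
        (fun z => φ z.2 z.1.2) (p, t) := by
    intro p
    rw [← lintegral_indicator measurableSet_Icc]
    rfl
  simp_rw [h]
  refine Measurable.lintegral_prod_right' (f := Set.indicator _ _) (Measurable.indicator ?_ ?_)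
  · exact hφ.comp (measurable_snd.prodMk (measurable_snd.comp measurable_fst))
  · have h1 : Measurable fun z : (ℝ × α) × ℝ => z.1.1 := by fun_prop
    exact (measurableSet_le h1 measurable_snd).inter
      (measurableSet_le measurable_snd (h1.add_const _))

lemma measurable_forwardMax {ψ : ℝ → ℝ≥0∞} (hψ : Measurable ψ) : Measurable (forwardMax ρ ψ) :=
  (measurable_forwardMax_uncurry (ρ := ρ) (φ := fun t (_ : Unit) => ψ t)
    (hψ.comp measurable_fst)).comp (f := fun s : ℝ => (s, ()))
      (measurable_id.prodMk measurable_const)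

lemma measure_lt_forwardMax_le (hρ : ∀ k, 0 < ρ k) (ψ : ℝ → ℝ≥0∞) {β : ℝ} (hβ : 0 < β) :
    volume {s | ENNReal.ofReal β < forwardMax ρ ψ s} ≤
      ENNReal.ofReal (8 / β) * ∫⁻ t, ψ t := by
  by_cases hfin : ∫⁻ t, ψ t = ∞
  · rw [hfin, ENNReal.mul_top (by simpa using by positivity)]
    exact le_top
  have hex : ∀ s, ∃ k : ℤ, s ∈ {s | ENNReal.ofReal β < forwardMax ρ ψ s} →
      ENNReal.ofReal (β * ρ k) ≤ ∫⁻ t in Metric.closedBall s (ρ k), ψ t := by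
    intro s
    by_cases hs : s ∈ {s | ENNReal.ofReal β < forwardMax ρ ψ s}
    · have hs' : ENNReal.ofReal β < forwardMax ρ ψ s := hs
      unfold forwardMax at hs'
      obtain ⟨k, hk⟩ := lt_iSup_iff.mp hs'
      refine ⟨k, fun _ => ?_⟩
      have h0 : ENNReal.ofReal (ρ k) ≠ 0 := by simpa using hρ k
      rw [← ENNReal.div_eq_inv_mul] at hk
      have h1 := (ENNReal.le_div_iff_mul_le (Or.inl h0) (Or.inl ENNReal.ofReal_ne_top)).mp hk.le
      rw [ENNReal.ofReal_mul hβ.le]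
      refine h1.trans (lintegral_mono_set ?_)
      rw [Real.closedBall_eq_Icc]
      exact Set.Icc_subset_Icc (by linarith [hρ k]) le_rfl
    · exact ⟨0, fun h => absurd h hs⟩
  choose k hk using hex
  set S := {s | ENNReal.ofReal β < forwardMax ρ ψ s} with hS
  obtain ⟨u, huS, hdisj, hcov⟩ := Vitali.exists_disjoint_subfamily_covering_enlargement_closedBall
    S (fun s => s) (fun s => ρ (k s)) ((∫⁻ t, ψ t).toReal / β) (fun s hs => by
      rw [le_div_iff₀ hβ, mul_comm, ← ENNReal.ofReal_le_iff_le_toReal hfin]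
      exact (hk s hs).trans (setLIntegral_le_lintegral _ _)) 4 (by norm_num)
  have hcount : u.Countable := by
    refine hdisj.countable_of_nonempty_interior fun s _ => ?_
    exact (Metric.nonempty_ball.mpr (hρ (k s))).mono Metric.ball_subset_interior_closedBall
  calc volume S ≤ volume (⋃ s ∈ u, Metric.closedBall s (4 * ρ (k s))) := by
        refine measure_mono fun s hs => ?_
        obtain ⟨b, hb, hsub⟩ := hcov s hs
        exact Set.mem_biUnion hb (hsub (Metric.mem_closedBall_self (hρ _).le))
    _ ≤ ∑' s : u, volume (Metric.closedBall (s : ℝ) (4 * ρ (k s))) :=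
        measure_biUnion_le volume hcount _
    _ ≤ ∑' s : u, ENNReal.ofReal (8 / β) *
          ∫⁻ t in Metric.closedBall (s : ℝ) (ρ (k s)), ψ t := by
        refine ENNReal.tsum_le_tsum fun s => ?_
        rw [Real.volume_closedBall]
        calc _ = ENNReal.ofReal (8 / β) * ENNReal.ofReal (β * ρ (k s)) := by
              rw [← ENNReal.ofReal_mul (by positivity)]
              congr 1; field_simp; ring
          _ ≤ _ := by gcongr; exact hk s (huS s.2)
    _ = ENNReal.ofReal (8 / β) * ∫⁻ t in ⋃ s ∈ u, Metric.closedBall s (ρ (k s)), ψ t := by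
        rw [ENNReal.tsum_mul_left, lintegral_biUnion hcount
          (fun s _ => Metric.isClosed_closedBall.measurableSet) hdisj]
    _ ≤ _ := by gcongr; exact Measure.restrict_le_self

lemma measure_lt_forwardMax_le_tail (hρ : ∀ k, 0 < ρ k) {ψ : ℝ → ℝ≥0∞} (hψ : Measurable ψ)
    {α : ℝ} (hα : 0 < α) :
    volume {s | ENNReal.ofReal α < forwardMax ρ ψ s} ≤
      ENNReal.ofReal (16 / α) * ∫⁻ t, {t | ENNReal.ofReal (α / 2) < ψ t}.indicator ψ t := by
  have hms : MeasurableSet {t | ENNReal.ofReal (α / 2) < ψ t} :=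
    measurableSet_lt measurable_const hψ
  set g := {t | ENNReal.ofReal (α / 2) < ψ t}.indicator ψ with hg
  have hgm : Measurable g := hψ.indicator hms
  have hle : ∀ t, ψ t ≤ g t + ENNReal.ofReal (α / 2) := by
    intro t
    by_cases ht : ENNReal.ofReal (α / 2) < ψ t
    · simp [hg, ht]
    · rw [hg, Set.indicator_of_notMem (by exact ht), zero_add]
      exact not_lt.mp ht
  have hM : ∀ s, forwardMax ρ ψ s ≤ forwardMax ρ g s + ENNReal.ofReal (α / 2) := by
    intro s
    refine iSup_le fun k => ?_
    have h0 : ENNReal.ofReal (ρ k) ≠ 0 := by simpa using hρ k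
    calc _ ≤ (ENNReal.ofReal (ρ k))⁻¹ *
          ∫⁻ t in Set.Icc s (s + ρ k), (g t + ENNReal.ofReal (α / 2)) := by
          gcongr; exact hle _
      _ = (ENNReal.ofReal (ρ k))⁻¹ * (∫⁻ t in Set.Icc s (s + ρ k), g t) +
          ENNReal.ofReal (α / 2) := by
          rw [lintegral_add_left hgm, mul_add, setLIntegral_const, Real.volume_Icc,
            add_sub_cancel_left, mul_comm (ENNReal.ofReal (α / 2)), ← mul_assoc,
            ENNReal.inv_mul_cancel h0 ENNReal.ofReal_ne_top, one_mul]
      _ ≤ _ := by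
          gcongr
          exact le_iSup (fun k => (ENNReal.ofReal (ρ k))⁻¹ * ∫⁻ t in Set.Icc s (s + ρ k), g t) k
  have hsub : {s | ENNReal.ofReal α < forwardMax ρ ψ s} ⊆
      {s | ENNReal.ofReal (α / 2) < forwardMax ρ g s} := by
    intro s hs
    by_contra hcon
    have h1 : forwardMax ρ g s ≤ ENNReal.ofReal (α / 2) := not_lt.mp hcon
    have h2 := (hM s).trans (add_le_add_left h1 _)
    rw [← ENNReal.ofReal_add (by positivity) (by positivity), add_halves] at h2
    exact absurd hs (not_lt.mpr h2)
  refine (measure_mono hsub).trans ((measure_lt_forwardMax_le hρ g (half_pos hα)).trans_eq ?_)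
  congr 2
  field_simp
  norm_num

lemma setLIntegral_Ioo_rpow {r c : ℝ} (hr : -1 < r) (hc : 0 ≤ c) :
    ∫⁻ α in Set.Ioo 0 c, ENNReal.ofReal (α ^ r) = ENNReal.ofReal (c ^ (r + 1) / (r + 1)) := by
  have hi : IntegrableOn (fun α : ℝ => α ^ r) (Set.Ioo 0 c) :=
    (intervalIntegrable_iff_integrableOn_Ioo_of_le hc).mp
      (intervalIntegral.intervalIntegrable_rpow' hr)
  rw [← ofReal_integral_eq_lintegral_ofReal hi]
  · rw [← integral_Ioc_eq_integral_Ioo, ← intervalIntegral.integral_of_le hc,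
      integral_rpow (Or.inl hr), Real.zero_rpow (by linarith), sub_zero]
  · filter_upwards [ae_restrict_mem measurableSet_Ioo] with α hα
    exact Real.rpow_nonneg hα.1.le _

/-- The one-sided maximal function is bounded on `L^κ`, `κ > 1`. -/
lemma lintegral_forwardMax_rpow_le (hρ : ∀ k, 0 < ρ k) {κ : ℝ} (hκ : 1 < κ) {ψ : ℝ → ℝ≥0∞}
    (hψ : Measurable ψ) {m : ℝ≥0∞} (hm : m ≠ ∞) (hψm : ∀ t, ψ t ≤ m) :
    ∫⁻ s, forwardMax ρ ψ s ^ κ ≤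
      ENNReal.ofReal (κ * (16 * (2 ^ (κ - 1) / (κ - 1)))) * ∫⁻ t, ψ t ^ κ := by
  have hfin : ∀ s, forwardMax ρ ψ s ≠ ∞ := fun s =>
    ne_top_of_le_ne_top hm (forwardMax_le_of_le hρ hψm s)
  have hψfin : ∀ t, ψ t ≠ ∞ := fun t => ne_top_of_le_ne_top hm (hψm t)
  have hMm : Measurable (fun s => (forwardMax ρ ψ s).toReal) :=
    (measurable_forwardMax hψ).ennreal_toReal
  have hlayer := lintegral_rpow_eq_lintegral_meas_lt_mul volume
    (f := fun s => (forwardMax ρ ψ s).toReal)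
    (Filter.Eventually.of_forall fun s => ENNReal.toReal_nonneg) hMm.aemeasurable
    (p := κ) (by linarith)
  have hset : ∀ α : ℝ, {t | ENNReal.ofReal (α / 2) < ψ t}.indicator ψ =
      fun t => {z : ℝ × ℝ | ENNReal.ofReal (z.1 / 2) < ψ z.2}.indicator (fun z => ψ z.2) (α, t) :=
    fun α => rfl
  calc ∫⁻ s, forwardMax ρ ψ s ^ κ
      = ∫⁻ s, ENNReal.ofReal ((forwardMax ρ ψ s).toReal ^ κ) := by
        congr 1; ext s
        rw [← ENNReal.ofReal_rpow_of_nonneg ENNReal.toReal_nonneg (by linarith),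
          ENNReal.ofReal_toReal (hfin s)]
    _ = ENNReal.ofReal κ * ∫⁻ α in Set.Ioi 0,
          volume {s | α < (forwardMax ρ ψ s).toReal} * ENNReal.ofReal (α ^ (κ - 1)) := hlayer
    _ ≤ ENNReal.ofReal κ * ∫⁻ α in Set.Ioi 0, ∫⁻ t, ENNReal.ofReal (16 * α ^ (κ - 2)) *
          {z : ℝ × ℝ | ENNReal.ofReal (z.1 / 2) < ψ z.2}.indicator (fun z => ψ z.2) (α, t) := by
        gcongr ENNReal.ofReal κ * ?_
        refine setLIntegral_mono' measurableSet_Ioi fun α (hα : 0 < α) => ?_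
        have h1 : {s | α < (forwardMax ρ ψ s).toReal} =
            {s | ENNReal.ofReal α < forwardMax ρ ψ s} := by
          ext s
          exact (ENNReal.ofReal_lt_iff_lt_toReal hα.le (hfin s)).symm
        rw [h1, lintegral_const_mul' _ _ ENNReal.ofReal_ne_top]
        refine (mul_le_mul_left (measure_lt_forwardMax_le_tail hρ hψ hα) _).trans_eq ?_
        rw [hset, mul_right_comm, ← ENNReal.ofReal_mul (by positivity)]
        congr 2
        rw [show κ - 1 = (κ - 2) + 1 by ring, Real.rpow_add_one hα.ne']
        field_simp
    _ = ENNReal.ofReal κ * ∫⁻ t, ∫⁻ α in Set.Ioi 0, ENNReal.ofReal (16 * α ^ (κ - 2)) *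
          {z : ℝ × ℝ | ENNReal.ofReal (z.1 / 2) < ψ z.2}.indicator (fun z => ψ z.2) (α, t) := by
        congr 1
        refine lintegral_lintegral_swap (Measurable.aemeasurable ?_)
        refine Measurable.mul (by fun_prop) (Measurable.indicator (by fun_prop) ?_)
        exact measurableSet_lt (by fun_prop) (by fun_prop)
    _ = ENNReal.ofReal κ * ∫⁻ t, ENNReal.ofReal (16 * (2 ^ (κ - 1) / (κ - 1))) * ψ t ^ κ := by
        congr 2; ext t
        lift ψ t to NNReal using hψfin t with c hc
        have h2 : ∀ α ∈ Set.Ioi (0 : ℝ), ENNReal.ofReal (16 * α ^ (κ - 2)) *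
            {z : ℝ × ℝ | ENNReal.ofReal (z.1 / 2) < ψ z.2}.indicator (fun z => ψ z.2) (α, t) =
            (Set.Ioo 0 (2 * (c : ℝ))).indicator
              (fun α => ENNReal.ofReal (16 * c) * ENNReal.ofReal (α ^ (κ - 2))) α := by
          intro α hα
          have hα' : 0 < α := hα
          have hiff : ENNReal.ofReal (α / 2) < ψ t ↔ α < 2 * (c : ℝ) := by
            rw [← hc, ENNReal.ofReal_lt_iff_lt_toReal (by positivity) (by simp),
              ENNReal.coe_toReal, div_lt_iff₀' (by norm_num)]
          by_cases h : α < 2 * (c : ℝ)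
          · rw [Set.indicator_of_mem (show (α, t) ∈ {z : ℝ × ℝ | ENNReal.ofReal (z.1 / 2) < ψ z.2} from hiff.mpr h),
              Set.indicator_of_mem (show α ∈ Set.Ioo 0 (2 * (c : ℝ)) from ⟨hα, h⟩), ← hc,
              ← ENNReal.ofReal_coe_nnreal, ← ENNReal.ofReal_mul (by positivity),
              ← ENNReal.ofReal_mul (by positivity)]
            congr 1; ring
          · rw [Set.indicator_of_notMem (show (α, t) ∉ {z : ℝ × ℝ | ENNReal.ofReal (z.1 / 2) < ψ z.2} from fun h' => h (hiff.mp h')),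
              Set.indicator_of_notMem (fun h' => h h'.2), mul_zero]
        rw [setLIntegral_congr_fun measurableSet_Ioi h2, lintegral_indicator measurableSet_Ioo,
          Measure.restrict_restrict measurableSet_Ioo,
          Set.inter_eq_left.mpr (fun α hα => hα.1),
          lintegral_const_mul' _ _ ENNReal.ofReal_ne_top,
          setLIntegral_Ioo_rpow (by linarith) (by positivity),
          ← ENNReal.ofReal_mul (by positivity), ← ENNReal.ofReal_coe_nnreal,
          ENNReal.ofReal_rpow_of_nonneg (NNReal.coe_nonneg c) (by linarith),
          ← ENNReal.ofReal_mul (mul_nonneg (by norm_num) (div_nonneg (by positivity)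
            (by linarith)))]
        congr 1
        rw [show κ - 2 + 1 = κ - 1 by ring, Real.mul_rpow (by norm_num) (NNReal.coe_nonneg c)]
        rcases eq_or_lt_of_le c.2 with h0 | h0
        · have : (c : ℝ) = 0 := h0.symm
          simp [this, Real.zero_rpow (show κ ≠ 0 by linarith)]
        · have h0' : (c : ℝ) ≠ 0 := h0.ne'
          rw [show (c : ℝ) ^ κ = (c : ℝ) ^ (κ - 1) * c by
            rw [← Real.rpow_add_one h0']; congr 1; ring]
          ring
    _ = _ := by
        rw [lintegral_const_mul' _ _ ENNReal.ofReal_ne_top, ← mul_assoc,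
          ← ENNReal.ofReal_mul (by linarith)]

end ForwardMaximal

section Bellman

/-- A function on `[0,∞) × [0,m]` having at every point a supporting function of the form
`y n² + η v - κ`, with `y ≥ c v` there. -/
structure IsBellman (B : ℝ → ℝ → ℝ≥0∞) (c m : ℝ) : Prop where
  measurable : Measurable (Function.uncurry B)
  exists_support : ∀ n v : ℝ, 0 ≤ n → 0 ≤ v → v ≤ m → ∃ y η κ : ℝ, c * v ≤ y ∧ 0 ≤ y ∧
    0 ≤ y * n ^ 2 + η * v - κ ∧ B n v ≤ ENNReal.ofReal (y * n ^ 2 + η * v - κ) ∧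
    ∀ n' v' : ℝ, 0 ≤ v' → v' ≤ m → ENNReal.ofReal (y * n' ^ 2 + η * v' - κ) ≤ B n' v'

lemma isBellman_sq : IsBellman (fun n _ => ENNReal.ofReal (n ^ 2)) 1 1 where
  measurable := by
    have : Measurable fun p : ℝ × ℝ => ENNReal.ofReal (p.1 ^ 2) := by fun_prop
    exact this
  exists_support n v _ _ hv := ⟨1, 0, 0, by linarith, zero_le_one, by simpa using sq_nonneg n,
    by simp, fun n' v' _ _ => by simp⟩

/-- The Bellman function adapted to the duality between `L^q` and its dual. -/
noncomputable def bellmanFun (q n v : ℝ) : ℝ≥0∞ :=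
  ⨆ w : NNReal, ENNReal.ofReal ((w : ℝ) ^ (q - 1) * n ^ 2 + w * v - (w : ℝ) ^ q)

lemma bellmanFun_le {q r : ℝ} (hq : q.HolderConjugate r) {n v : ℝ} (hn : 0 ≤ n) (hv : 0 ≤ v) :
    bellmanFun q n v ≤ ENNReal.ofReal (n ^ (2 * q)) + ENNReal.ofReal (v ^ r) := by
  rw [← ENNReal.ofReal_add (by positivity) (by positivity)]
  refine iSup_le fun w => ENNReal.ofReal_le_ofReal ?_
  have h1 := Real.young_inequality_of_nonneg (Real.rpow_nonneg (NNReal.coe_nonneg w) (q - 1))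
    (sq_nonneg n) hq.symm
  have h2 := Real.young_inequality_of_nonneg (NNReal.coe_nonneg w) hv hq
  rw [← Real.rpow_mul (NNReal.coe_nonneg w), hq.sub_one_mul_conj,
    show (n ^ 2) ^ q = n ^ (2 * q) by
      rw [← Real.rpow_natCast n, ← Real.rpow_mul hn, Nat.cast_ofNat]] at h1
  have h3 : (w : ℝ) ^ q / r + (w : ℝ) ^ q / q = (w : ℝ) ^ q := by
    rw [div_eq_mul_inv, div_eq_mul_inv, ← mul_add, add_comm, hq.inv_add_inv_eq_one, mul_one]
  have h4 : n ^ (2 * q) / q ≤ n ^ (2 * q) := div_le_self (by positivity) hq.lt.le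
  have h5 : v ^ r / r ≤ v ^ r := div_le_self (by positivity) hq.symm.lt.le
  linarith

lemma isBellman_bellmanFun {q : ℝ} (hq : 1 < q) (m : ℝ) : IsBellman (bellmanFun q) (1 / q) m where
  measurable := by
    refine LowerSemicontinuous.measurable (lowerSemicontinuous_iSup fun w =>
      Continuous.lowerSemicontinuous ?_)
    exact ENNReal.continuous_ofReal.comp (by fun_prop)
  exists_support n v hn hv _ := by
    have hq0 : 0 < q := by linarith
    have hq1 : 0 < q - 1 := by linarith
    set f : ℝ → ℝ := fun w => w ^ (q - 1) * n ^ 2 + w * v - w ^ q with hf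
    have hfc : Continuous f := by
      have h1 : Continuous fun w : ℝ => w ^ (q - 1) := Real.continuous_rpow_const hq1.le
      have h2 : Continuous fun w : ℝ => w ^ q := Real.continuous_rpow_const hq0.le
      fun_prop
    have hf0 : f 0 = 0 := by simp [hf, Real.zero_rpow hq1.ne', Real.zero_rpow hq0.ne']
    set R : ℝ := max (2 * n ^ 2) ((2 * v) ^ (1 / (q - 1))) with hR
    have hR0 : 0 ≤ R := le_max_of_le_left (by positivity)
    have hbig : ∀ w, R ≤ w → f w ≤ 0 := by
      intro w hw
      have hw0 : 0 ≤ w := hR0.trans hw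
      have hwq : w ^ q = w ^ (q - 1) * w := by
        rcases hw0.eq_or_lt with h | h
        · simp [← h, Real.zero_rpow hq0.ne']
        · rw [← Real.rpow_add_one h.ne']; congr 1; ring
      have h1 : 2 * n ^ 2 ≤ w := (le_max_left _ _).trans hw
      have h2 : 2 * v ≤ w ^ (q - 1) := by
        have := Real.rpow_le_rpow (by positivity) ((le_max_right _ _).trans hw) hq1.le
        rwa [← Real.rpow_mul (by positivity), one_div_mul_cancel hq1.ne', Real.rpow_one] at this
      have h3 : w ^ (q - 1) * (2 * n ^ 2) ≤ w ^ (q - 1) * w := by gcongr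
      have h4 : (2 * v) * w ≤ w ^ (q - 1) * w := by gcongr
      simp only [hf, hwq]
      linarith
    obtain ⟨w₀, ⟨hw₀, -⟩, hmax⟩ := isCompact_Icc.exists_isMaxOn
      (Set.nonempty_Icc.mpr hR0) hfc.continuousOn
    have hmax' : ∀ w, 0 ≤ w → f w ≤ f w₀ := by
      intro w hw
      rcases le_total w R with h | h
      · exact hmax ⟨hw, h⟩
      · exact (hbig w h).trans (hf0 ▸ hmax (Set.left_mem_Icc.mpr hR0))
    have hy : v ≤ q * w₀ ^ (q - 1) := by
      have hlim : Filter.Tendsto (fun w : ℝ => q * w ^ (q - 1)) (nhdsWithin w₀ (Set.Ioi w₀))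
          (nhds (q * w₀ ^ (q - 1))) :=
        ((Real.continuous_rpow_const hq1.le).const_mul q).continuousWithinAt
      refine ge_of_tendsto hlim ?_
      filter_upwards [self_mem_nhdsWithin] with w hw
      have hw : w₀ < w := hw
      have hw' : 0 < w := hw₀.trans_lt hw
      have h1 := hmax' w hw'.le
      have h2 : w₀ ^ (q - 1) ≤ w ^ (q - 1) := Real.rpow_le_rpow hw₀ hw.le hq1.le
      have h3 : w₀ ^ (q - 1) * n ^ 2 ≤ w ^ (q - 1) * n ^ 2 := by gcongr
      have h4 : (w - w₀) * v ≤ w ^ q - w₀ ^ q := by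
        simp only [hf] at h1
        linarith
      have h5 := one_add_mul_self_le_rpow_one_add (s := w₀ / w - 1)
        (by linarith [div_nonneg hw₀ hw'.le]) hq.le
      rw [add_sub_cancel, Real.div_rpow hw₀ hw'.le, le_div_iff₀ (by positivity)] at h5
      have h6 : w ^ q = w ^ (q - 1) * w := by
        rw [← Real.rpow_add_one hw'.ne']; congr 1; ring
      have h7 : (1 + q * (w₀ / w - 1)) * w ^ q = w ^ q - q * w ^ (q - 1) * (w - w₀) := by
        rw [h6]; field_simp; ring
      rw [h7] at h5
      have h8 : v * (w - w₀) ≤ q * w ^ (q - 1) * (w - w₀) := by linarith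
      exact le_of_mul_le_mul_right h8 (by linarith)
    refine ⟨w₀ ^ (q - 1), w₀, w₀ ^ q, ?_, by positivity, ?_, ?_, fun n' v' _ _ => ?_⟩
    · rw [one_div, inv_mul_le_iff₀ hq0]; exact hy
    · exact hf0 ▸ hmax' 0 le_rfl
    · exact iSup_le fun w => ENNReal.ofReal_le_ofReal (hmax' w (NNReal.coe_nonneg w))
    · exact le_iSup (fun w : NNReal =>
        ENNReal.ofReal ((w : ℝ) ^ (q - 1) * n' ^ 2 + w * v' - (w : ℝ) ^ q)) ⟨w₀, hw₀⟩

variable {V : Type*} [NormedAddCommGroup V] [InnerProductSpace ℝ V] [CompleteSpace V]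

lemma integral_norm_sq_eq {α : Type*} [MeasurableSpace α] {μ : Measure α}
    [IsProbabilityMeasure μ] {u : α → V} {C : ℝ} (hu : StronglyMeasurable u)
    (hC : ∀ x, ‖u x‖ ≤ C) :
    ∫ x, ‖u x‖ ^ 2 ∂μ = ‖∫ x, u x ∂μ‖ ^ 2 + ∫ x, ‖u x - ∫ z, u z ∂μ‖ ^ 2 ∂μ := by
  have hC0 : ∀ x, ‖u x‖ ^ 2 ≤ C ^ 2 := fun x => by
    have := hC x; gcongr
  have hi : Integrable u μ := .of_bound hu.aestronglyMeasurable C (.of_forall hC)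
  have hi2 : Integrable (fun x => ‖u x‖ ^ 2) μ :=
    .of_bound (hu.norm.pow 2).aestronglyMeasurable (C ^ 2) (.of_forall fun x => by
      simpa using hC0 x)
  set U := ∫ z, u z ∂μ with hU
  have h1 : ∀ x, ‖u x - U‖ ^ 2 = ‖u x‖ ^ 2 - 2 * inner ℝ U (u x) + ‖U‖ ^ 2 := fun x => by
    rw [norm_sub_sq_real, real_inner_comm]
  simp_rw [h1]
  have hi3 : Integrable (fun x => 2 * inner ℝ U (u x)) μ := (hi.const_inner U).const_mul 2
  have hi4 : Integrable (fun x => ‖u x‖ ^ 2 - 2 * inner ℝ U (u x)) μ := hi2.sub hi3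
  rw [integral_add hi4 (integrable_const _), integral_sub hi2 hi3,
    integral_const_mul, integral_inner hi, ← hU, real_inner_self_eq_norm_sq]
  simp
  ring

lemma IsBellman.add_le_lintegral {B : ℝ → ℝ → ℝ≥0∞} {c m : ℝ} (hB : IsBellman B c m)
    {α : Type*} [MeasurableSpace α] {μ : Measure α} [IsProbabilityMeasure μ] {u : α → V} {C : ℝ}
    (hu : StronglyMeasurable u) (hC : ∀ x, ‖u x‖ ≤ C) {v : α → ℝ} (hv : Measurable v)
    (hv0 : ∀ x, 0 ≤ v x) (hvm : ∀ x, v x ≤ m) :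
    B ‖∫ x, u x ∂μ‖ (∫ x, v x ∂μ) +
      ENNReal.ofReal (c * ∫ x, v x ∂μ) * ∫⁻ x, ‖u x - ∫ z, u z ∂μ‖ₑ ^ 2 ∂μ ≤
    ∫⁻ x, B ‖u x‖ (v x) ∂μ := by
  have hiv : Integrable v μ := .of_bound hv.aestronglyMeasurable m (.of_forall fun x => by
    rw [Real.norm_of_nonneg (hv0 x)]; exact hvm x)
  have hi2 : Integrable (fun x => ‖u x‖ ^ 2) μ :=
    .of_bound (hu.norm.pow 2).aestronglyMeasurable (C ^ 2) (.of_forall fun x => by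
      have := hC x
      simp only [norm_pow, norm_norm]; gcongr)
  set U := ∫ z, u z ∂μ with hU
  have hiV : Integrable (fun x => ‖u x - U‖ ^ 2) μ :=
    .of_bound ((hu.sub stronglyMeasurable_const).norm.pow 2).aestronglyMeasurable
      ((C + ‖U‖) ^ 2) (.of_forall fun x => by
        have := (norm_sub_le (u x) U).trans (add_le_add_left (hC x) _)
        simp only [norm_pow, norm_norm]; gcongr)
  have hvm' : ∫ x, v x ∂μ ≤ m := by
    simpa using integral_mono hiv (integrable_const m) hvm
  obtain ⟨y, η, κ, hcy, hy, hnn, hle, hsup⟩ := hB.exists_support ‖U‖ (∫ x, v x ∂μ)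
    (norm_nonneg _) (integral_nonneg hv0) hvm'
  have hvar : ∫⁻ x, ‖u x - U‖ₑ ^ 2 ∂μ = ENNReal.ofReal (∫ x, ‖u x - U‖ ^ 2 ∂μ) := by
    rw [ofReal_integral_eq_lintegral_ofReal hiV (.of_forall fun x => by positivity)]
    simp_rw [ENNReal.ofReal_pow (norm_nonneg _), ofReal_norm]
  have hvar0 : 0 ≤ ∫ x, ‖u x - U‖ ^ 2 ∂μ := integral_nonneg fun x => by positivity
  have hi3 : Integrable (fun x => y * ‖u x‖ ^ 2 + η * v x) μ :=
    (hi2.const_mul y).add (hiv.const_mul η)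
  have hi4 : Integrable (fun x => y * ‖u x‖ ^ 2 + η * v x - κ) μ := hi3.sub (integrable_const κ)
  calc _ ≤ ENNReal.ofReal (y * ‖U‖ ^ 2 + η * (∫ x, v x ∂μ) - κ) +
        ENNReal.ofReal y * ENNReal.ofReal (∫ x, ‖u x - U‖ ^ 2 ∂μ) := by
        rw [hvar]; gcongr
    _ = ENNReal.ofReal (∫ x, (y * ‖u x‖ ^ 2 + η * v x - κ) ∂μ) := by
        rw [← ENNReal.ofReal_mul hy, ← ENNReal.ofReal_add hnn (by positivity),
          integral_sub hi3 (integrable_const _),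
          integral_add (hi2.const_mul y) (hiv.const_mul η), integral_const_mul,
          integral_const_mul, integral_norm_sq_eq hu hC, ← hU]
        simp
        congr 1; ring
    _ ≤ ∫⁻ x, ENNReal.ofReal (y * ‖u x‖ ^ 2 + η * v x - κ) ∂μ := by
        refine ENNReal.ofReal_le_of_le_toReal ?_
        rw [integral_eq_lintegral_pos_part_sub_lintegral_neg_part hi4]
        exact sub_le_self _ ENNReal.toReal_nonneg
    _ ≤ _ := lintegral_mono fun x => hsup _ _ (hv0 x) (hvm x)

end Bellman

section Ladder

variable {d : ℕ} {V : Type*} [NormedAddCommGroup V] [InnerProductSpace ℝ V] [CompleteSpace V]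

lemma tsum_int_le_of_telescoping {G D : ℤ → ℝ≥0∞} {A : ℝ≥0∞} (h : ∀ k, G (k + 1) + D k ≤ G k)
    (hG : ∀ k, G k ≤ A) : ∑' k, D k ≤ A := by
  have hind : ∀ (a : ℤ) (n : ℕ), G (a + n) + ∑ i ∈ Finset.range n, D (a + i) ≤ G a := by
    intro a n
    induction n with
    | zero => simp
    | succ n ih =>
      rw [Finset.sum_range_succ, Nat.cast_succ, ← add_assoc a, add_comm (∑ i ∈ _, _), ← add_assoc]
      exact (add_le_add_left (h _) _).trans ih
  rw [ENNReal.tsum_eq_iSup_sum]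
  refine iSup_le fun S => ?_
  obtain ⟨a, ha⟩ := S.bddBelow
  obtain ⟨b, hb⟩ := S.bddAbove
  have hsub : S ⊆ (Finset.range (b + 1 - a).toNat).image (fun i : ℕ => a + i) := by
    intro k hk
    have h1 := ha hk
    have h2 := hb hk
    refine Finset.mem_image.mpr ⟨(k - a).toNat, ?_, ?_⟩
    · rw [Finset.mem_range]; omega
    · omega
  calc ∑ k ∈ S, D k ≤ ∑ k ∈ (Finset.range (b + 1 - a).toNat).image (fun i : ℕ => a + i), D k :=
        Finset.sum_le_sum_of_subset hsub
    _ = ∑ i ∈ Finset.range (b + 1 - a).toNat, D (a + i) :=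
        Finset.sum_image fun i _ j _ hij => by simpa using hij
    _ ≤ _ := (le_add_self.trans (hind a _)).trans (hG a)

lemma IsBellman.measurable_comp {B : ℝ → ℝ → ℝ≥0∞} {c m : ℝ} (hB : IsBellman B c m)
    {W : Type*} [NormedAddCommGroup W] {α : Type*} [MeasurableSpace α] {u : α → W}
    (hu : StronglyMeasurable u) {v : α → ℝ} (hv : Measurable v) :
    Measurable fun x => B ‖u x‖ (v x) :=
  hB.measurable.comp (hu.norm.measurable.prodMk hv)

lemma IsBellman.heatOp_step {B : ℝ → ℝ → ℝ≥0∞} {c m : ℝ} (hB : IsBellman B c m) {h C : ℝ}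
    (hh : 0 < h) {u : EuclideanSpace ℝ (Fin d) → V} (hu : StronglyMeasurable u)
    (hC : ∀ x, ‖u x‖ ≤ C) {v : EuclideanSpace ℝ (Fin d) → ℝ} (hv : Measurable v)
    (hv0 : ∀ x, 0 ≤ v x) (hvm : ∀ x, v x ≤ m) :
    (∫⁻ x, B ‖heatOp d h u x‖ (heatOp d h v x)) +
      ∫⁻ x, ENNReal.ofReal (c * heatOp d h v x) *
        ∫⁻ y, ‖u (x - y) - heatOp d h u x‖ₑ ^ 2 ∂(heatMeasure d h) ≤
    ∫⁻ x, B ‖u x‖ (v x) := by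
  have := isProbabilityMeasure_heatMeasure (d := d) hh
  rw [← lintegral_lintegral_heatMeasure hh (hB.measurable_comp hu hv),
    ← lintegral_add_left (hB.measurable_comp (stronglyMeasurable_heatOp hu)
      (stronglyMeasurable_heatOp hv.stronglyMeasurable).measurable)]
  refine lintegral_mono fun x => ?_
  have := hB.add_le_lintegral (μ := heatMeasure d h) (u := fun y => u (x - y))
    (v := fun y => v (x - y)) (hu.comp_measurable (by fun_prop)) (fun y => hC _)
    (hv.comp (by fun_prop)) (fun y => hv0 _) (fun y => hvm _)
  simpa only [← heatOp_eq_integral hh] using this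

/-- The geometric scales at which the heat semigroup is sampled. -/
noncomputable def heatScale (k : ℤ) : ℝ := (4 / 3 : ℝ) ^ k

lemma heatScale_pos (k : ℤ) : 0 < heatScale k := zpow_pos (by norm_num) k

lemma heatScale_add_one (k : ℤ) : heatScale (k + 1) = 4 / 3 * heatScale k := by
  rw [heatScale, heatScale, zpow_add_one₀ (by norm_num), mul_comm]

lemma heatOp_nonneg {t : ℝ} (ht : 0 < t) {v : EuclideanSpace ℝ (Fin d) → ℝ} (hv : ∀ x, 0 ≤ v x)
    (x : EuclideanSpace ℝ (Fin d)) : 0 ≤ heatOp d t v x := by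
  rw [heatOp_eq_integral ht]
  exact integral_nonneg fun y => hv _

lemma IsBellman.tsum_heatOp_le {B : ℝ → ℝ → ℝ≥0∞} {c m : ℝ} (hB : IsBellman B c m) {C : ℝ}
    {g : EuclideanSpace ℝ (Fin d) → V} (hg : StronglyMeasurable g)
    (hC : ∀ x, ‖g x‖ ≤ C) {v : EuclideanSpace ℝ (Fin d) → ℝ} (hv : Measurable v)
    (hv0 : ∀ x, 0 ≤ v x) (hvm : ∀ x, v x ≤ m) :
    ∑' k : ℤ, ∫⁻ x, ENNReal.ofReal (c * heatOp d (heatScale (k + 1)) v x) *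
        ∫⁻ y, ‖heatOp d (heatScale k) g (x - y) - heatOp d (heatScale (k + 1)) g x‖ₑ ^ 2
          ∂(heatMeasure d (heatScale (k + 1) / 4)) ≤
    ∫⁻ x, B ‖g x‖ (v x) := by
  have hvC : ∀ x, ‖v x‖ ≤ m := fun x => by rw [Real.norm_of_nonneg (hv0 x)]; exact hvm x
  refine tsum_int_le_of_telescoping
    (G := fun k => ∫⁻ x, B ‖heatOp d (heatScale k) g x‖ (heatOp d (heatScale k) v x))
    (fun k => ?_) (fun k => ?_)
  · have hk := heatScale_pos k
    have hk1 := heatScale_pos (k + 1)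
    have hsum : heatScale (k + 1) / 4 + heatScale k = heatScale (k + 1) := by
      rw [heatScale_add_one]; ring
    have := hB.heatOp_step (h := heatScale (k + 1) / 4) (by linarith)
      (stronglyMeasurable_heatOp (t := heatScale k) hg) (norm_heatOp_le hk hC)
      (stronglyMeasurable_heatOp (t := heatScale k) hv.stronglyMeasurable).measurable
      (heatOp_nonneg hk hv0)
      (fun x => (Real.le_norm_self _).trans (norm_heatOp_le hk hvC x))
    simpa only [heatOp_heatOp (show 0 < heatScale (k + 1) / 4 by linarith) hk hg hC,
      heatOp_heatOp (show 0 < heatScale (k + 1) / 4 by linarith) hk hv.stronglyMeasurable hvC,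
      hsum] using this
  · exact le_self_add.trans (hB.heatOp_step (heatScale_pos k) hg hC hv hv0 hvm)

lemma ofReal_heatOp_toReal {t : ℝ} (ht : 0 < t) {Ψ : EuclideanSpace ℝ (Fin d) → ℝ≥0∞}
    (hΨ : Measurable Ψ) {m : ℝ} (hm : ∀ x, Ψ x ≤ ENNReal.ofReal m)
    (x : EuclideanSpace ℝ (Fin d)) :
    ENNReal.ofReal (heatOp d t (fun y => (Ψ y).toReal) x) =
      ∫⁻ y, Ψ (x - y) ∂(heatMeasure d t) := by
  have := isProbabilityMeasure_heatMeasure (d := d) ht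
  have hfin : ∀ x, Ψ x ≠ ∞ := fun x => ne_top_of_le_ne_top ENNReal.ofReal_ne_top (hm x)
  rw [heatOp_eq_integral ht, ofReal_integral_eq_lintegral_ofReal]
  · simp_rw [ENNReal.ofReal_toReal (hfin _)]
  · refine .of_bound (hΨ.ennreal_toReal.comp (by fun_prop)).aestronglyMeasurable
      (ENNReal.ofReal m).toReal (.of_forall fun y => ?_)
    rw [Real.norm_of_nonneg ENNReal.toReal_nonneg]
    exact ENNReal.toReal_mono ENNReal.ofReal_ne_top (hm _)
  · exact .of_forall fun y => ENNReal.toReal_nonneg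

/-- Square function estimate with a weight, at the geometric scales. -/
lemma IsBellman.tsum_heatScale_grad_le {B : ℝ → ℝ → ℝ≥0∞} {c m : ℝ} (hB : IsBellman B c m)
    (hc : 0 < c) (hm0 : 0 ≤ m) {g : EuclideanSpace ℝ (Fin d) → V} (hg : ContDiff ℝ 1 g)
    (hgc : HasCompactSupport g) {Ψ : EuclideanSpace ℝ (Fin d) → ℝ≥0∞} (hΨ : Measurable Ψ)
    (hm : ∀ x, Ψ x ≤ ENNReal.ofReal m) :
    ∑' k : ℤ, ENNReal.ofReal (heatScale k) * ∫⁻ x,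
      (∑ j : Fin d, ‖heatOp d (heatScale k)
        (fun y => fderiv ℝ g y (EuclideanSpace.single j 1)) x‖ₑ ^ 2) *
        ∫⁻ y, Ψ (x - y) ∂(heatMeasure d (heatScale k)) ≤
    ENNReal.ofReal (d * (8 * 2 ^ ((d : ℝ)/2)) / c) * ∫⁻ x, B ‖g x‖ (Ψ x).toReal := by
  obtain ⟨C, hC⟩ := hgc.exists_bound_of_continuous hg.continuous
  have hgs : StronglyMeasurable g := hg.continuous.stronglyMeasurable_of_hasCompactSupport hgc
  have hdc : ∀ j : Fin d, Continuous fun y => fderiv ℝ g y (EuclideanSpace.single j 1) :=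
    fun j => (hg.continuous_fderiv one_ne_zero).clm_apply continuous_const
  have hdcs : ∀ j : Fin d, HasCompactSupport
      fun y => fderiv ℝ g y (EuclideanSpace.single j 1) := fun j => hgc.fderiv_apply ℝ _
  have hds : ∀ j : Fin d, StronglyMeasurable
      fun y => fderiv ℝ g y (EuclideanSpace.single j 1) :=
    fun j => (hdc j).stronglyMeasurable_of_hasCompactSupport (hdcs j)
  choose C' hC' using fun j : Fin d => (hdcs j).exists_bound_of_continuous (hdc j)
  have hmain := hB.tsum_heatOp_le hgs hC hΨ.ennreal_toReal (fun _ => ENNReal.toReal_nonneg)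
    (fun x => ENNReal.toReal_le_of_le_ofReal hm0 (hm x))
  rw [← (Equiv.addRight (1 : ℤ)).tsum_eq]
  simp only [Equiv.coe_addRight]
  calc _ ≤ ∑' k : ℤ, ENNReal.ofReal (d * (8 * 2 ^ ((d : ℝ)/2)) / c) *
        ∫⁻ x, ENNReal.ofReal (c * heatOp d (heatScale (k + 1)) (fun y => (Ψ y).toReal) x) *
        ∫⁻ y, ‖heatOp d (heatScale k) g (x - y) - heatOp d (heatScale (k + 1)) g x‖ₑ ^ 2
          ∂(heatMeasure d (heatScale (k + 1) / 4)) := by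
        refine ENNReal.tsum_le_tsum fun k => ?_
        have hk := heatScale_pos k
        have hk1 := heatScale_pos (k + 1)
        have hsum : heatScale (k + 1) / 4 + heatScale k = heatScale (k + 1) := by
          rw [heatScale_add_one]; ring
        rw [← lintegral_const_mul' _ _ ENNReal.ofReal_ne_top,
          ← lintegral_const_mul' _ _ ENNReal.ofReal_ne_top]
        refine lintegral_mono fun x => ?_
        rw [← ofReal_heatOp_toReal hk1 hΨ hm]
        set X := ∫⁻ y, ‖heatOp d (heatScale k) g (x - y) - heatOp d (heatScale (k + 1)) g x‖ₑ ^ 2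
          ∂(heatMeasure d (heatScale (k + 1) / 4)) with hX
        have hj : ∀ j : Fin d, ‖heatOp d (heatScale (k + 1))
            (fun y => fderiv ℝ g y (EuclideanSpace.single j 1)) x‖ₑ ^ 2 ≤
            ENNReal.ofReal (8 * 2 ^ ((d : ℝ)/2) / heatScale (k + 1)) * X := by
          intro j
          have h1 := enorm_heatOp_fderiv_sq_le (t := heatScale (k + 1) / 4) (by linarith)
            (u := heatOp d (heatScale k) g) (e := EuclideanSpace.single j 1) (C' := C' j)
            (by simp) (contDiff_heatOp hk hg hgc) (norm_heatOp_le hk hC)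
            (fun y => by rw [fderiv_heatOp hk hg hgc]; exact norm_heatOp_le hk (hC' j) y) x
            (heatOp d (heatScale (k + 1)) g x)
          simp_rw [fderiv_heatOp hk hg hgc] at h1
          rw [show (fun y => heatOp d (heatScale k) (fun y => fderiv ℝ g y
            (EuclideanSpace.single j 1)) y) = heatOp d (heatScale k) (fun y => fderiv ℝ g y
            (EuclideanSpace.single j 1)) from rfl,
            heatOp_heatOp (by linarith) hk (hds j) (hC' j), hsum] at h1
          refine h1.trans_eq ?_
          congr 2
          field_simp
          norm_num
        set H := heatOp d (heatScale (k + 1)) (fun y => (Ψ y).toReal) x with hH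
        have hH0 : 0 ≤ H := heatOp_nonneg hk1 (fun _ => ENNReal.toReal_nonneg) x
        calc _ ≤ ENNReal.ofReal (heatScale (k + 1)) * ((∑ _j : Fin d,
              ENNReal.ofReal (8 * 2 ^ ((d : ℝ)/2) / heatScale (k + 1)) * X) *
              ENNReal.ofReal H) := by
              gcongr with j; exact hj j
          _ = _ := by
              rw [Finset.sum_const, Finset.card_univ, Fintype.card_fin, nsmul_eq_mul,
                ← ENNReal.ofReal_natCast, ← mul_assoc (ENNReal.ofReal (d : ℝ)),
                mul_right_comm _ X, ← mul_assoc, ← mul_assoc, ← mul_assoc,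
                ← ENNReal.ofReal_mul (by positivity), ← ENNReal.ofReal_mul (by positivity),
                ← ENNReal.ofReal_mul (by positivity), ← mul_assoc,
                ← ENNReal.ofReal_mul (by positivity)]
              congr 2
              field_simp
    _ ≤ _ := by
        rw [ENNReal.tsum_mul_left]
        gcongr

end Ladder

section Duality

/-- An `L^q` bound obtained from a (non-homogeneous) dual estimate. -/
lemma lintegral_rpow_le_of_dual {α : Type*} [MeasurableSpace α] {μ : Measure α} [SigmaFinite μ]
    {q r : ℝ} (hqr : q.HolderConjugate r) {Q : α → ℝ≥0∞} (hQ : Measurable Q) {C D ε : ℝ}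
    (hε : 0 < ε) (hD : D * ε ^ (r - 1) ≤ 1 / 2) (hC0 : 0 < C) (hD0 : 0 ≤ D) {A : ℝ≥0∞}
    (h : ∀ (m : ℝ) (φ : α → ℝ≥0∞), 0 ≤ m → Measurable φ → (∀ x, φ x ≤ ENNReal.ofReal m) →
      ∫⁻ x, Q x * φ x ∂μ ≤ ENNReal.ofReal C * A + ENNReal.ofReal D * ∫⁻ x, φ x ^ r ∂μ) :
    ∫⁻ x, Q x ^ q ∂μ ≤ ENNReal.ofReal (2 * C / ε) * A := by
  have hq0 : 0 < q := hqr.pos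
  have hq1 : 0 < q - 1 := hqr.sub_one_pos
  have hr0 : 0 < r := hqr.symm.pos
  set J : ℕ → α → ℝ≥0∞ := fun n => (spanningSets μ n).indicator fun x => min (Q x) n ^ q with hJ
  have hJm : ∀ n, Measurable (J n) := fun n =>
    ((hQ.min measurable_const).pow_const q).indicator (measurableSet_spanningSets μ n)
  have hbound : ∀ n, ∫⁻ x, J n x ∂μ ≤ ENNReal.ofReal (2 * C / ε) * A := by
    intro n
    set φ : α → ℝ≥0∞ := (spanningSets μ n).indicator fun x =>
      ENNReal.ofReal ε * min (Q x) n ^ (q - 1) with hφ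
    have hφm : Measurable φ := (((hQ.min measurable_const).pow_const _).const_mul _).indicator
      (measurableSet_spanningSets μ n)
    have hφb : ∀ x, φ x ≤ ENNReal.ofReal (ε * (n : ℝ) ^ (q - 1)) := by
      intro x
      refine Set.indicator_apply_le' (fun _ => ?_) (fun _ => zero_le)
      rw [ENNReal.ofReal_mul hε.le, ← ENNReal.ofReal_rpow_of_nonneg (Nat.cast_nonneg n) hq1.le,
        ENNReal.ofReal_natCast]
      gcongr
      exact min_le_right _ _
    have h1 : ∀ x, ENNReal.ofReal ε * J n x ≤ Q x * φ x := by
      intro x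
      by_cases hx : x ∈ spanningSets μ n
      · simp only [hJ, hφ, Set.indicator_of_mem hx]
        rw [mul_left_comm]
        gcongr
        calc min (Q x) n ^ q = min (Q x) n ^ (1 + (q - 1)) := by congr 1; ring
          _ = min (Q x) n * min (Q x) n ^ (q - 1) := by
              rw [ENNReal.rpow_add_of_nonneg _ _ zero_le_one hq1.le, ENNReal.rpow_one]
          _ ≤ _ := by gcongr; exact min_le_left _ _
      · simp [hJ, hφ, Set.indicator_of_notMem hx]
    have h2 : ∀ x, φ x ^ r = ENNReal.ofReal (ε ^ r) * J n x := by
      intro x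
      by_cases hx : x ∈ spanningSets μ n
      · simp only [hJ, hφ, Set.indicator_of_mem hx]
        rw [ENNReal.mul_rpow_of_nonneg _ _ hr0.le, ← ENNReal.rpow_mul, hqr.sub_one_mul_conj,
          ENNReal.ofReal_rpow_of_nonneg hε.le hr0.le]
      · simp [hJ, hφ, Set.indicator_of_notMem hx, hr0]
    have hfin : ∫⁻ x, J n x ∂μ ≠ ∞ := by
      refine ne_top_of_le_ne_top (ENNReal.mul_ne_top (b := μ (spanningSets μ n))
        (a := (n : ℝ≥0∞) ^ q) (ENNReal.rpow_ne_top_of_nonneg hq0.le (ENNReal.natCast_ne_top n))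
        (measure_spanningSets_lt_top μ n).ne) ?_
      rw [hJ, lintegral_indicator (measurableSet_spanningSets μ n), ← setLIntegral_const]
      refine lintegral_mono fun x => ?_
      gcongr
      exact min_le_right _ _
    have h3 := h _ φ (by positivity) hφm hφb
    simp_rw [h2] at h3
    have h4 := (lintegral_mono h1).trans h3
    rw [lintegral_const_mul _ (hJm n), lintegral_const_mul _ (hJm n), ← mul_assoc,
      ← ENNReal.ofReal_mul hD0] at h4
    rcases eq_or_ne A ∞ with hA | hA
    · rw [hA, ENNReal.mul_top (by simpa using by positivity)]
      exact le_top
    lift A to NNReal using hA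
    generalize ∫⁻ x, J n x ∂μ = I at *
    lift I to NNReal using hfin
    rw [← ENNReal.ofReal_coe_nnreal (p := A), ← ENNReal.ofReal_coe_nnreal (p := I)] at *
    have hI := NNReal.coe_nonneg I
    have hA := NNReal.coe_nonneg A
    rw [← ENNReal.ofReal_mul hε.le, ← ENNReal.ofReal_mul hC0.le,
      ← ENNReal.ofReal_mul (by positivity), ← ENNReal.ofReal_add (by positivity) (by positivity),
      ENNReal.ofReal_le_ofReal_iff (by positivity)] at h4
    rw [← ENNReal.ofReal_mul (by positivity)]
    refine ENNReal.ofReal_le_ofReal ?_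
    have h5 : D * ε ^ r ≤ ε / 2 := by
      rw [show ε ^ r = ε ^ (r - 1) * ε by rw [← Real.rpow_add_one hε.ne']; congr 1; ring,
        ← mul_assoc]
      nlinarith
    have h6 : D * ε ^ r * (I : ℝ) ≤ ε / 2 * I := by gcongr
    rw [div_mul_eq_mul_div, le_div_iff₀ hε]
    linarith
  have hlim : ∀ x, Filter.Tendsto (fun n => J n x) Filter.atTop (nhds (Q x ^ q)) := by
    intro x
    have h1 : Filter.Tendsto (fun n : ℕ => min (Q x) (n : ℝ≥0∞)) Filter.atTop (nhds (Q x)) := by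
      simpa using (tendsto_const_nhds (x := Q x)).min ENNReal.tendsto_nat_nhds_top
    refine ((ENNReal.continuous_rpow_const.tendsto _).comp h1).congr' ?_
    filter_upwards [Filter.eventually_ge_atTop (spanningSetsIndex μ x)] with n hn
    simp [hJ, Set.indicator_of_mem (mem_spanningSets_of_index_le μ x hn)]
  calc ∫⁻ x, Q x ^ q ∂μ = ∫⁻ x, Filter.liminf (fun n => J n x) Filter.atTop ∂μ := by
        simp_rw [(hlim _).liminf_eq]
    _ ≤ Filter.liminf (fun n => ∫⁻ x, J n x ∂μ) Filter.atTop := lintegral_liminf_le hJm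
    _ ≤ _ := Filter.liminf_le_of_frequently_le' (Filter.Frequently.of_forall hbound)

variable {d : ℕ}

lemma lintegral_heatMeasure_mul {t : ℝ} (ht : 0 < t) {P M : EuclideanSpace ℝ (Fin d) → ℝ≥0∞}
    (hP : Measurable P) (hM : Measurable M) :
    ∫⁻ x, (∫⁻ y, P (x - y) ∂(heatMeasure d t)) * M x =
      ∫⁻ x, P x * ∫⁻ y, M (x - y) ∂(heatMeasure d t) := by
  have := isProbabilityMeasure_heatMeasure (d := d) ht
  have hPx : ∀ x, Measurable fun y => P (x - y) := fun x =>
    hP.comp (measurable_const.sub measurable_id)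
  have hMx : ∀ x, Measurable fun y => M (x - y) := fun x =>
    hM.comp (measurable_const.sub measurable_id)
  have hMx' : ∀ x, Measurable fun y => M (x + y) := fun x =>
    hM.comp (measurable_const.add measurable_id)
  calc _ = ∫⁻ x, (∫⁻ y, P (x - y) * M x ∂(heatMeasure d t)) := by
        congr 1; ext x
        rw [lintegral_mul_const _ (hPx x)]
    _ = ∫⁻ y, (∫⁻ x, P (x - y) * M x) ∂(heatMeasure d t) := by
        refine lintegral_lintegral_swap (Measurable.aemeasurable ?_)
        exact (hP.comp (measurable_fst.sub measurable_snd)).mul (hM.comp measurable_fst)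
    _ = ∫⁻ y, (∫⁻ x, P x * M (x + y)) ∂(heatMeasure d t) := by
        congr 1; ext y
        rw [← lintegral_add_right_eq_self _ y]
        simp
    _ = ∫⁻ x, (∫⁻ y, P x * M (x + y) ∂(heatMeasure d t)) := by
        refine lintegral_lintegral_swap (Measurable.aemeasurable ?_)
        exact (hP.comp measurable_snd).mul (hM.comp (measurable_snd.add measurable_fst))
    _ = _ := by
        congr 1; ext x
        rw [lintegral_const_mul _ (hMx' x), ← lintegral_comp_neg_heatMeasure t (hMx x)]
        simp

end Duality

section WindowSum

variable {d : ℕ}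

/-- Superposition over the scales `k` of the Gaussian averages of `P k s`, with `t - s` localised
to the `k`-th window. -/
noncomputable def windowSum (P : ℤ → ℝ → EuclideanSpace ℝ (Fin d) → ℝ≥0∞)
    (z : EuclideanSpace ℝ (Fin d) × ℝ) : ℝ≥0∞ :=
  ∑' k : ℤ, ∫⁻ s, (Set.Ico (heatScale (k + 1)) (heatScale (k + 2))).indicator 1 (z.2 - s) *
    ∫⁻ y, P k s (z.1 - y) ∂(heatMeasure d (heatScale k))

variable {P : ℤ → ℝ → EuclideanSpace ℝ (Fin d) → ℝ≥0∞}

lemma measurable_heatMeasure_average {t : ℝ} (ht : 0 < t)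
    {F : ℝ → EuclideanSpace ℝ (Fin d) → ℝ≥0∞} (hF : Measurable (Function.uncurry F)) :
    Measurable fun z : EuclideanSpace ℝ (Fin d) × ℝ =>
      ∫⁻ y, F z.2 (z.1 - y) ∂(heatMeasure d t) := by
  have := isProbabilityMeasure_heatMeasure (d := d) ht
  refine Measurable.lintegral_prod_right' (f := fun w : (EuclideanSpace ℝ (Fin d) × ℝ) ×
    EuclideanSpace ℝ (Fin d) => F w.1.2 (w.1.1 - w.2)) ?_
  exact hF.comp (measurable_fst.snd.prodMk (measurable_fst.fst.sub measurable_snd))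

lemma measurable_window (k : ℤ) : Measurable fun w : ℝ × ℝ =>
    (Set.Ico (heatScale (k + 1)) (heatScale (k + 2))).indicator (1 : ℝ → ℝ≥0∞) (w.1 - w.2) :=
  (measurable_one.indicator measurableSet_Ico).comp (measurable_fst.sub measurable_snd)

lemma measurable_windowSum_term (hP : ∀ k, Measurable (Function.uncurry (P k))) (k : ℤ) :
    Measurable fun z : EuclideanSpace ℝ (Fin d) × ℝ =>
      ∫⁻ s, (Set.Ico (heatScale (k + 1)) (heatScale (k + 2))).indicator 1 (z.2 - s) *
        ∫⁻ y, P k s (z.1 - y) ∂(heatMeasure d (heatScale k)) := by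
  refine Measurable.lintegral_prod_right' (f := fun w : (EuclideanSpace ℝ (Fin d) × ℝ) × ℝ =>
    (Set.Ico (heatScale (k + 1)) (heatScale (k + 2))).indicator 1 (w.1.2 - w.2) *
        ∫⁻ y, P k w.2 (w.1.1 - y) ∂(heatMeasure d (heatScale k))) ?_
  exact ((measurable_window k).comp (measurable_fst.snd.prodMk measurable_snd)).mul
    ((measurable_heatMeasure_average (heatScale_pos k) (hP k)).comp
      (measurable_fst.fst.prodMk measurable_snd))

lemma measurable_windowSum (hP : ∀ k, Measurable (Function.uncurry (P k))) :
    Measurable (windowSum P) :=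
  Measurable.tsum fun k => measurable_windowSum_term hP k

lemma heatScale_add_two_le (k : ℤ) : heatScale (k + 2) ≤ 2 * heatScale k := by
  rw [show k + 2 = k + 1 + 1 by ring, heatScale_add_one, heatScale_add_one]
  linarith [heatScale_pos k]

lemma lintegral_window_mul_le (k : ℤ) (ψ : ℝ → ℝ≥0∞) (s : ℝ) :
    ∫⁻ t, (Set.Ico (heatScale (k + 1)) (heatScale (k + 2))).indicator 1 (t - s) * ψ t ≤
      ENNReal.ofReal (2 * heatScale k) * forwardMax (fun k => 2 * heatScale k) ψ s := by
  have hk := heatScale_pos k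
  have hk1 := heatScale_pos (k + 1)
  have h0 : ENNReal.ofReal (2 * heatScale k) ≠ 0 := by simpa using hk
  calc _ ≤ ∫⁻ t, (Set.Icc s (s + 2 * heatScale k)).indicator ψ t := by
        refine lintegral_mono fun t => ?_
        by_cases ht : t - s ∈ Set.Ico (heatScale (k + 1)) (heatScale (k + 2))
        · have h2 := heatScale_add_two_le k
          rw [Set.indicator_of_mem ht, Set.indicator_of_mem (Set.mem_Icc.mpr
            ⟨by linarith [ht.1], by linarith [ht.2]⟩), Pi.one_apply, one_mul]
        · rw [Set.indicator_of_notMem ht, zero_mul]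
          exact zero_le
    _ = ∫⁻ t in Set.Icc s (s + 2 * heatScale k), ψ t := lintegral_indicator measurableSet_Icc _
    _ = ENNReal.ofReal (2 * heatScale k) * ((ENNReal.ofReal (2 * heatScale k))⁻¹ *
          ∫⁻ t in Set.Icc s (s + 2 * heatScale k), ψ t) := by
        rw [← mul_assoc, ENNReal.mul_inv_cancel h0 ENNReal.ofReal_ne_top, one_mul]
    _ ≤ _ := by
        gcongr
        exact le_iSup (fun k => (ENNReal.ofReal (2 * heatScale k))⁻¹ *
          ∫⁻ t in Set.Icc s (s + 2 * heatScale k), ψ t) k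

lemma measurable_forwardMax_slice {φ : EuclideanSpace ℝ (Fin d) × ℝ → ℝ≥0∞} (hφ : Measurable φ)
    (ρ : ℤ → ℝ) : Measurable (Function.uncurry fun (s : ℝ) (x : EuclideanSpace ℝ (Fin d)) =>
      forwardMax ρ (fun t => φ (x, t)) s) :=
  measurable_forwardMax_uncurry (φ := fun t x => φ (x, t))
    (hφ.comp (measurable_snd.prodMk measurable_fst))

lemma lintegral_windowSum_mul_le (hP : ∀ k, Measurable (Function.uncurry (P k)))
    {φ : EuclideanSpace ℝ (Fin d) × ℝ → ℝ≥0∞} (hφ : Measurable φ) :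
    ∫⁻ x, ∫⁻ t, windowSum P (x, t) * φ (x, t) ≤
      ∑' k : ℤ, ENNReal.ofReal (2 * heatScale k) * ∫⁻ s, ∫⁻ x, P k s x *
        ∫⁻ y, forwardMax (fun k => 2 * heatScale k) (fun t => φ (x - y, t)) s
          ∂(heatMeasure d (heatScale k)) := by
  have hterm : ∀ k, Measurable fun z : EuclideanSpace ℝ (Fin d) × ℝ =>
      (∫⁻ s, (Set.Ico (heatScale (k + 1)) (heatScale (k + 2))).indicator 1 (z.2 - s) *
        ∫⁻ y, P k s (z.1 - y) ∂(heatMeasure d (heatScale k))) * φ z :=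
    fun k => (measurable_windowSum_term hP k).mul hφ
  have hM := measurable_forwardMax_slice hφ (fun k => 2 * heatScale k)
  calc _ = ∑' k : ℤ, ∫⁻ x, ∫⁻ t, (∫⁻ s,
          (Set.Ico (heatScale (k + 1)) (heatScale (k + 2))).indicator 1 (t - s) *
            ∫⁻ y, P k s (x - y) ∂(heatMeasure d (heatScale k))) * φ (x, t) := by
        rw [← lintegral_tsum fun k => (hterm k).lintegral_prod_right'.aemeasurable]
        congr 1; ext x
        have hx : ∀ k, Measurable fun t => (∫⁻ s,
            (Set.Ico (heatScale (k + 1)) (heatScale (k + 2))).indicator 1 (t - s) *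
              ∫⁻ y, P k s (x - y) ∂(heatMeasure d (heatScale k))) * φ (x, t) := fun k =>
          (hterm k).comp measurable_prodMk_left
        simp only
        rw [← lintegral_tsum fun k => (hx k).aemeasurable]
        congr 1; ext t
        rw [windowSum, ENNReal.tsum_mul_right]
    _ ≤ _ := ENNReal.tsum_le_tsum fun k => ?_
  have hk := heatScale_pos k
  have := isProbabilityMeasure_heatMeasure (d := d) hk
  have hK := measurable_heatMeasure_average hk (hP k)
  set K : EuclideanSpace ℝ (Fin d) → ℝ → ℝ≥0∞ := fun x s =>
    ∫⁻ y, P k s (x - y) ∂(heatMeasure d (heatScale k)) with hKdef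
  set M : ℝ → EuclideanSpace ℝ (Fin d) → ℝ≥0∞ := fun s x =>
    forwardMax (fun k => 2 * heatScale k) (fun t => φ (x, t)) s with hMdef
  calc _ = ∫⁻ x, ∫⁻ s, K x s * ∫⁻ t,
          (Set.Ico (heatScale (k + 1)) (heatScale (k + 2))).indicator 1 (t - s) * φ (x, t) := by
        congr 1; ext x
        have hKx : Measurable (K x) := hK.comp measurable_prodMk_left
        have hφx : Measurable fun t => φ (x, t) := hφ.comp measurable_prodMk_left
        have hw1 : ∀ t, Measurable fun s => (Set.Ico (heatScale (k + 1))
            (heatScale (k + 2))).indicator (1 : ℝ → ℝ≥0∞) (t - s) := fun t =>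
          (measurable_window k).comp measurable_prodMk_left
        have hw2 : ∀ s, Measurable fun t => (Set.Ico (heatScale (k + 1))
            (heatScale (k + 2))).indicator (1 : ℝ → ℝ≥0∞) (t - s) := fun s =>
          (measurable_window k).comp measurable_prodMk_right
        calc _ = ∫⁻ t, ∫⁻ s, (Set.Ico (heatScale (k + 1))
                (heatScale (k + 2))).indicator 1 (t - s) * K x s * φ (x, t) := by
              congr 1; ext t
              exact (lintegral_mul_const _ ((hw1 t).mul hKx)).symm
          _ = ∫⁻ s, ∫⁻ t, (Set.Ico (heatScale (k + 1))
                (heatScale (k + 2))).indicator 1 (t - s) * K x s * φ (x, t) :=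
              lintegral_lintegral_swap (((measurable_window k).mul
                (hKx.comp measurable_snd)).mul (hφx.comp measurable_fst)).aemeasurable
          _ = _ := by
              congr 1; ext s
              have hwφ : Measurable fun t => (Set.Ico (heatScale (k + 1))
                  (heatScale (k + 2))).indicator (1 : ℝ → ℝ≥0∞) (t - s) * φ (x, t) :=
                (hw2 s).mul hφx
              rw [← lintegral_const_mul _ hwφ]
              congr 1; ext t
              ring
    _ ≤ ∫⁻ x, ∫⁻ s, K x s * (ENNReal.ofReal (2 * heatScale k) * M s x) := by
        gcongr with x s
        exact lintegral_window_mul_le k _ s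
    _ = ENNReal.ofReal (2 * heatScale k) * ∫⁻ x, ∫⁻ s, K x s * M s x := by
        simp_rw [mul_left_comm (K _ _), lintegral_const_mul' _ _ ENNReal.ofReal_ne_top]
    _ = ENNReal.ofReal (2 * heatScale k) * ∫⁻ s, ∫⁻ x, K x s * M s x := by
        congr 1
        refine lintegral_lintegral_swap (Measurable.aemeasurable ?_)
        exact hK.mul (hM.comp measurable_swap)
    _ = _ := by
        congr 2; ext s
        exact lintegral_heatMeasure_mul hk ((hP k).comp measurable_prodMk_left)
          (hM.comp measurable_prodMk_left)

lemma exists_mem_window {r : ℝ} (hr : 0 < r) :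
    ∃ k : ℤ, r ∈ Set.Ico (heatScale (k + 1)) (heatScale (k + 2)) := by
  obtain ⟨n, hn⟩ := exists_mem_Ico_zpow hr (show (1 : ℝ) < 4 / 3 by norm_num)
  refine ⟨n - 1, ?_⟩
  rw [sub_add_cancel, show n - 1 + 2 = n + 1 by ring]
  exact hn

lemma setLIntegral_le_windowSum (hP : ∀ k, Measurable (Function.uncurry (P k)))
    {F : ℝ → ℝ≥0∞} {C : ℝ≥0∞} (hC : C ≠ ∞) (z : EuclideanSpace ℝ (Fin d) × ℝ)
    (h : ∀ k s, z.2 - s ∈ Set.Ico (heatScale (k + 1)) (heatScale (k + 2)) →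
      F s ≤ C * ∫⁻ y, P k s (z.1 - y) ∂(heatMeasure d (heatScale k)))
    {S : Set ℝ} (hS : S ⊆ Set.Iio z.2) :
    ∫⁻ s in S, F s ≤ C * windowSum P z := by
  have hw : ∀ k, Measurable fun s => (Set.Ico (heatScale (k + 1))
      (heatScale (k + 2))).indicator (1 : ℝ → ℝ≥0∞) (z.2 - s) := fun k =>
    (measurable_window k).comp measurable_prodMk_left
  have hK : ∀ k, Measurable fun s =>
      ∫⁻ y, P k s (z.1 - y) ∂(heatMeasure d (heatScale k)) := fun k =>
    (measurable_heatMeasure_average (heatScale_pos k) (hP k)).comp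
      (measurable_prodMk_left (x := z.1))
  have hmeas : ∀ k, Measurable fun s => (Set.Ico (heatScale (k + 1))
      (heatScale (k + 2))).indicator (1 : ℝ → ℝ≥0∞) (z.2 - s) *
        ∫⁻ y, P k s (z.1 - y) ∂(heatMeasure d (heatScale k)) := fun k =>
    (hw k).mul (hK k)
  rw [windowSum, ← lintegral_tsum fun k => (hmeas k).aemeasurable, ← lintegral_const_mul' _ _ hC]
  refine (lintegral_mono_set hS).trans ?_
  refine (setLIntegral_mono' measurableSet_Iio fun s (hs : s < z.2) => ?_).trans
    (setLIntegral_le_lintegral (Set.Iio z.2) _)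
  obtain ⟨k, hk⟩ := exists_mem_window (sub_pos.mpr hs)
  refine (h k s hk).trans ?_
  gcongr
  refine le_trans ?_ (ENNReal.le_tsum k)
  rw [Set.indicator_of_mem hk, Pi.one_apply, one_mul]

end WindowSum

section Slices

variable {d : ℕ} {V : Type*} [NormedAddCommGroup V] [NormedSpace ℝ V]
  {f : ℝ × EuclideanSpace ℝ (Fin d) → V}

lemma fderiv_slice (hf : ContDiff ℝ 1 f) (s : ℝ) (y e : EuclideanSpace ℝ (Fin d)) :
    fderiv ℝ (fun z => f (s, z)) y e = fderiv ℝ f (s, y) (0, e) := by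
  have h1 : HasFDerivAt f (fderiv ℝ f (s, y)) (s, y) :=
    (hf.differentiable one_ne_zero _).hasFDerivAt
  have h2 := h1.comp y (hasFDerivAt_prodMk_right s y)
  rw [show (fun z => f (s, z)) = f ∘ fun z => (s, z) from rfl, h2.fderiv]
  simp

lemma contDiff_slice (hf : ContDiff ℝ 1 f) (s : ℝ) : ContDiff ℝ 1 fun z => f (s, z) :=
  hf.comp (contDiff_prodMk_right s)

omit [NormedSpace ℝ V] in
lemma hasCompactSupport_slice (hfc : HasCompactSupport f) (s : ℝ) :
    HasCompactSupport fun z => f (s, z) :=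
  hfc.comp_isClosedEmbedding ⟨isEmbedding_prodMkRight s, by
    simpa [Set.singleton_prod] using isClosed_singleton (x := s) |>.prod isClosed_univ⟩

end Slices

section GradientAverages

variable {d : ℕ} {V : Type*} [NormedAddCommGroup V] [InnerProductSpace ℝ V] [CompleteSpace V]

/-- The squared gradient of `f (s, ·)` regularised at the `k`-th scale. -/
noncomputable def gradScale (f : ℝ × EuclideanSpace ℝ (Fin d) → V) (k : ℤ) (s : ℝ)
    (x : EuclideanSpace ℝ (Fin d)) : ℝ≥0∞ :=
  ∑ j : Fin d, ‖heatOp d (heatScale k)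
    (fun y => fderiv ℝ (fun z => f (s, z)) y (EuclideanSpace.single j 1)) x‖ₑ ^ 2

variable {f : ℝ × EuclideanSpace ℝ (Fin d) → V}

lemma measurable_gradScale (hf : ContDiff ℝ 1 f) (hfc : HasCompactSupport f) (k : ℤ) :
    Measurable (Function.uncurry (gradScale f k)) := by
  change Measurable fun z : ℝ × EuclideanSpace ℝ (Fin d) => ∑ j : Fin d,
    ‖heatOp d (heatScale k) (fun y => fderiv ℝ (fun w => f (z.1, w)) y
      (EuclideanSpace.single j 1)) z.2‖ₑ ^ 2
  refine Finset.measurable_fun_sum (f := fun (j : Fin d) (z : ℝ × EuclideanSpace ℝ (Fin d)) =>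
    ‖heatOp d (heatScale k) (fun y => fderiv ℝ (fun w => f (z.1, w)) y
      (EuclideanSpace.single j 1)) z.2‖ₑ ^ 2) _ fun j _ => Measurable.pow_const ?_ 2
  have hc : Continuous fun z : ℝ × EuclideanSpace ℝ (Fin d) =>
      fderiv ℝ f z (0, EuclideanSpace.single j 1) :=
    (hf.continuous_fderiv one_ne_zero).clm_apply continuous_const
  have hs : StronglyMeasurable fun z : ℝ × EuclideanSpace ℝ (Fin d) =>
      fderiv ℝ f z (0, EuclideanSpace.single j 1) :=
    hc.stronglyMeasurable_of_hasCompactSupport (hfc.fderiv_apply ℝ _)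
  refine StronglyMeasurable.enorm (f := fun z : ℝ × EuclideanSpace ℝ (Fin d) =>
    heatOp d (heatScale k)
      (fun y => fderiv ℝ (fun w => f (z.1, w)) y (EuclideanSpace.single j 1)) z.2) ?_
  simp only [fderiv_slice hf, heatOp]
  refine StronglyMeasurable.integral_prod_right' (f := fun w : (ℝ × EuclideanSpace ℝ (Fin d)) ×
    EuclideanSpace ℝ (Fin d) => heatKernel d (heatScale k) w.2 •
      fderiv ℝ f (w.1.1, w.1.2 - w.2) (0, EuclideanSpace.single j 1)) ?_
  exact ((continuous_heatKernel _).stronglyMeasurable.comp_measurable measurable_snd).smul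
    (hs.comp_measurable (measurable_fst.fst.prodMk (measurable_fst.snd.sub measurable_snd)))

lemma ofReal_gradHeatNormSq_le (hf : ContDiff ℝ 1 f) (hfc : HasCompactSupport f) {k : ℤ} {r : ℝ}
    (hr : r ∈ Set.Ico (heatScale (k + 1)) (heatScale (k + 2))) (s : ℝ)
    (x : EuclideanSpace ℝ (Fin d)) :
    ENNReal.ofReal (gradHeatNormSq d r (fun y => f (s, y)) x) ≤
      ENNReal.ofReal (3 ^ ((d : ℝ)/2)) *
        ∫⁻ y, gradScale f k s (x - y) ∂(heatMeasure d (heatScale k)) := by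
  have hk := heatScale_pos k
  have h1 := heatScale_add_one k
  have h2 : heatScale (k + 2) = 4 / 3 * heatScale (k + 1) := by
    rw [← heatScale_add_one]; congr 1; ring
  have hr1 := hr.1
  have hr2 := hr.2
  have hg := contDiff_slice hf s
  have hgc := hasCompactSupport_slice hfc s
  have hdc : ∀ j : Fin d, Continuous
      fun y => fderiv ℝ (fun z => f (s, z)) y (EuclideanSpace.single j 1) :=
    fun j => (hg.continuous_fderiv one_ne_zero).clm_apply continuous_const
  have hdcs : ∀ j : Fin d, HasCompactSupport
      fun y => fderiv ℝ (fun z => f (s, z)) y (EuclideanSpace.single j 1) :=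
    fun j => hgc.fderiv_apply ℝ _
  have hds := fun j => (hdc j).stronglyMeasurable_of_hasCompactSupport (hdcs j)
  have hm : ∀ j : Fin d, Measurable fun y => ‖heatOp d (heatScale k)
      (fun y => fderiv ℝ (fun z => f (s, z)) y (EuclideanSpace.single j 1)) y‖ₑ ^ 2 := fun j =>
    (stronglyMeasurable_heatOp (hds j)).enorm.pow_const 2
  have hmx : ∀ j : Fin d, Measurable fun y => ‖heatOp d (heatScale k)
      (fun y => fderiv ℝ (fun z => f (s, z)) y (EuclideanSpace.single j 1)) (x - y)‖ₑ ^ 2 :=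
    fun j => (hm j).comp (measurable_const.sub measurable_id)
  rw [gradHeatNormSq, ENNReal.ofReal_sum_of_nonneg fun j _ => by positivity]
  simp only [gradScale]
  rw [lintegral_finsetSum _ fun j _ => hmx j, Finset.mul_sum]
  refine Finset.sum_le_sum fun j _ => ?_
  obtain ⟨C, hC⟩ := (hdcs j).exists_bound_of_continuous (hdc j)
  rw [ENNReal.ofReal_pow (norm_nonneg _), ofReal_norm, fderiv_heatOp (by linarith) hg hgc]
  have h3 := heatOp_heatOp (a := r - heatScale k) (by linarith) hk (hds j) hC x
  rw [sub_add_cancel] at h3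
  rw [← h3]
  refine (enorm_heatOp_sq_le (by linarith) (stronglyMeasurable_heatOp (hds j)) x).trans ?_
  exact lintegral_heatMeasure_le (by norm_num) (by linarith) (by linarith) (by linarith) (hmx j)

lemma lintegral_gradHeatNormSq_le (hf : ContDiff ℝ 1 f) (hfc : HasCompactSupport f)
    (S : Set ℝ) (t : ℝ) (hS : S ⊆ Set.Iio t) (x : EuclideanSpace ℝ (Fin d)) :
    ∫⁻ s in S, ENNReal.ofReal (gradHeatNormSq d (t - s) (fun y => f (s, y)) x) ≤
      ENNReal.ofReal (3 ^ ((d : ℝ)/2)) * windowSum (gradScale f) (x, t) :=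
  setLIntegral_le_windowSum (measurable_gradScale hf hfc) ENNReal.ofReal_ne_top (x, t)
    (fun _ s hk => ofReal_gradHeatNormSq_le hf hfc hk s x) hS

/-- The weighted estimate dual to the square function bound. -/
lemma IsBellman.lintegral_windowSum_gradScale_mul_le {B : ℝ → ℝ → ℝ≥0∞} {c m : ℝ}
    (hB : IsBellman B c m) (hc : 0 < c) (hm0 : 0 ≤ m) (hf : ContDiff ℝ 1 f)
    (hfc : HasCompactSupport f) {φ : EuclideanSpace ℝ (Fin d) × ℝ → ℝ≥0∞} (hφ : Measurable φ)
    (hm : ∀ z, φ z ≤ ENNReal.ofReal m) :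
    ∫⁻ x, ∫⁻ t, windowSum (gradScale f) (x, t) * φ (x, t) ≤
      ENNReal.ofReal (2 * (d * (8 * 2 ^ ((d : ℝ)/2)) / c)) * ∫⁻ s, ∫⁻ x, B ‖f (s, x)‖
        (forwardMax (fun k => 2 * heatScale k) (fun t => φ (x, t)) s).toReal := by
  have hP := measurable_gradScale hf hfc
  have hM := measurable_forwardMax_slice hφ (fun k => 2 * heatScale k)
  refine (lintegral_windowSum_mul_le hP hφ).trans ?_
  set M : ℝ → EuclideanSpace ℝ (Fin d) → ℝ≥0∞ := fun s x =>
    forwardMax (fun k => 2 * heatScale k) (fun t => φ (x, t)) s with hMdef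
  have hterm : ∀ k, Measurable fun s => ∫⁻ x, gradScale f k s x *
      ∫⁻ y, M s (x - y) ∂(heatMeasure d (heatScale k)) := fun k =>
    ((hP k).mul ((measurable_heatMeasure_average (heatScale_pos k) hM).comp
      measurable_swap)).lintegral_prod_right'
  calc _ = ENNReal.ofReal 2 * ∫⁻ s, ∑' k : ℤ, ENNReal.ofReal (heatScale k) *
          ∫⁻ x, gradScale f k s x * ∫⁻ y, M s (x - y) ∂(heatMeasure d (heatScale k)) := by
        rw [lintegral_tsum fun k => ((hterm k).const_mul _).aemeasurable,
          ← ENNReal.tsum_mul_left]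
        congr 1; ext k
        rw [lintegral_const_mul' _ _ ENNReal.ofReal_ne_top, ← mul_assoc,
          ← ENNReal.ofReal_mul zero_le_two]
    _ ≤ ENNReal.ofReal 2 * ∫⁻ s, ENNReal.ofReal (d * (8 * 2 ^ ((d : ℝ)/2)) / c) *
          ∫⁻ x, B ‖f (s, x)‖ (M s x).toReal := by
        gcongr with s
        exact hB.tsum_heatScale_grad_le hc hm0 (contDiff_slice hf s)
          (hasCompactSupport_slice hfc s) (hM.comp measurable_prodMk_left)
          (fun x => forwardMax_le_of_le (fun k => by linarith [heatScale_pos k]) (fun t => hm _) s)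
    _ = _ := by
        rw [lintegral_const_mul' _ _ ENNReal.ofReal_ne_top, ← mul_assoc,
          ← ENNReal.ofReal_mul zero_le_two]

end GradientAverages

section SquareFunction

variable {d : ℕ}

lemma exists_lintegral_windowSum_gradScale_le (hd : 1 ≤ d) :
    ∃ N : ℝ, 0 < N ∧ ∀ (V : Type) [NormedAddCommGroup V] [InnerProductSpace ℝ V] [CompleteSpace V]
      (f : ℝ × EuclideanSpace ℝ (Fin d) → V), ContDiff ℝ 1 f → HasCompactSupport f →
      ∫⁻ z, windowSum (gradScale f) z ≤
        ENNReal.ofReal N * ∫⁻ s, ∫⁻ x, ENNReal.ofReal (‖f (s, x)‖ ^ 2) := by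
  have hd' : (0 : ℝ) < d := by exact_mod_cast hd
  refine ⟨2 * (d * (8 * 2 ^ ((d : ℝ)/2)) / 1), by positivity, fun V _ _ _ f hf hfc => ?_⟩
  have h := isBellman_sq.lintegral_windowSum_gradScale_mul_le one_pos zero_le_one hf hfc
    (φ := fun _ => 1) measurable_const (fun _ => by simp)
  simp only [mul_one] at h
  rwa [Measure.volume_eq_prod,
    lintegral_prod _ (measurable_windowSum (measurable_gradScale hf hfc)).aemeasurable]

lemma exists_lintegral_windowSum_gradScale_rpow_le_of_one_lt (hd : 1 ≤ d) {q : ℝ} (hq : 1 < q) :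
    ∃ N : ℝ, 0 < N ∧ ∀ (V : Type) [NormedAddCommGroup V] [InnerProductSpace ℝ V] [CompleteSpace V]
      (f : ℝ × EuclideanSpace ℝ (Fin d) → V), ContDiff ℝ 1 f → HasCompactSupport f →
      ∫⁻ z, windowSum (gradScale f) z ^ q ≤
        ENNReal.ofReal N * ∫⁻ s, ∫⁻ x, ENNReal.ofReal (‖f (s, x)‖ ^ (2 * q)) := by
  have hd' : (0 : ℝ) < d := by exact_mod_cast hd
  have hq0 : 0 < q := one_pos.trans hq
  have hqr := Real.HolderConjugate.conjExponent hq
  set r := q.conjExponent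
  have hr : 1 < r := hqr.symm.lt
  have hr1 : 0 < r - 1 := sub_pos.mpr hr
  have hr0 : 0 < r := one_pos.trans hr
  set C : ℝ := 2 * (d * (8 * 2 ^ ((d : ℝ)/2)) / (1 / q)) with hC
  set L : ℝ := r * (16 * (2 ^ (r - 1) / (r - 1))) with hL
  have hC0 : 0 < C := by positivity
  have hL0 : 0 < L := by positivity
  set ε : ℝ := (1 / (2 * (C * L))) ^ (r - 1)⁻¹ with hε
  have hε0 : 0 < ε := by positivity
  have hεr : ε ^ (r - 1) = 1 / (2 * (C * L)) := by
    rw [hε, ← Real.rpow_mul (by positivity), inv_mul_cancel₀ hr1.ne', Real.rpow_one]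
  refine ⟨2 * C / ε, by positivity, fun V _ _ _ f hf hfc => ?_⟩
  refine lintegral_rpow_le_of_dual hqr (D := C * L)
    (measurable_windowSum (measurable_gradScale hf hfc)) hε0
    (by rw [hεr]; field_simp; exact le_rfl) hC0 (by positivity) fun m φ hm0 hφ hφm => ?_
  have hρ : ∀ k : ℤ, 0 < 2 * heatScale k := fun k => by linarith [heatScale_pos k]
  have hM := measurable_forwardMax_slice hφ (fun k => 2 * heatScale k)
  have hMle : ∀ s x, forwardMax (fun k => 2 * heatScale k) (fun t => φ (x, t)) s ≤
      ENNReal.ofReal m := fun s x => forwardMax_le_of_le hρ (fun t => hφm _) s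
  have h := (isBellman_bellmanFun hq m).lintegral_windowSum_gradScale_mul_le (by positivity) hm0 hf
    hfc hφ hφm
  have hfm : Measurable fun z => ENNReal.ofReal (‖f z‖ ^ (2 * q)) :=
    (hf.continuous.norm.rpow_const fun _ => Or.inr (by positivity)).measurable.ennreal_ofReal
  have hfx : ∀ s, Measurable fun x => ENNReal.ofReal (‖f (s, x)‖ ^ (2 * q)) := fun s =>
    hfm.comp measurable_prodMk_left
  calc ∫⁻ z, windowSum (gradScale f) z * φ z
      = ∫⁻ x, ∫⁻ t, windowSum (gradScale f) (x, t) * φ (x, t) := by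
        rw [Measure.volume_eq_prod]
        exact lintegral_prod _
          ((measurable_windowSum (measurable_gradScale hf hfc)).mul hφ).aemeasurable
    _ ≤ _ := h
    _ ≤ ENNReal.ofReal C * ∫⁻ s, ∫⁻ x, (ENNReal.ofReal (‖f (s, x)‖ ^ (2 * q)) +
          forwardMax (fun k => 2 * heatScale k) (fun t => φ (x, t)) s ^ r) := by
        gcongr with s x
        refine (bellmanFun_le hqr (norm_nonneg _) ENNReal.toReal_nonneg).trans_eq ?_
        rw [← ENNReal.ofReal_rpow_of_nonneg ENNReal.toReal_nonneg hr0.le,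
          ENNReal.ofReal_toReal (ne_top_of_le_ne_top ENNReal.ofReal_ne_top (hMle s x))]
    _ = ENNReal.ofReal C * ((∫⁻ s, ∫⁻ x, ENNReal.ofReal (‖f (s, x)‖ ^ (2 * q))) +
          ∫⁻ s, ∫⁻ x, forwardMax (fun k => 2 * heatScale k) (fun t => φ (x, t)) s ^ r) := by
        rw [← lintegral_add_left hfm.lintegral_prod_right']
        congr 2; ext s
        exact lintegral_add_left (hfx s) _
    _ = ENNReal.ofReal C * (∫⁻ s, ∫⁻ x, ENNReal.ofReal (‖f (s, x)‖ ^ (2 * q))) +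
          ENNReal.ofReal C *
            ∫⁻ x, ∫⁻ s, forwardMax (fun k => 2 * heatScale k) (fun t => φ (x, t)) s ^ r := by
        rw [mul_add]
        congr 2
        exact lintegral_lintegral_swap (hM.pow_const r).aemeasurable
    _ ≤ ENNReal.ofReal C * (∫⁻ s, ∫⁻ x, ENNReal.ofReal (‖f (s, x)‖ ^ (2 * q))) +
          ENNReal.ofReal C * ∫⁻ x, ENNReal.ofReal L * ∫⁻ t, φ (x, t) ^ r := by
        gcongr with x
        exact lintegral_forwardMax_rpow_le hρ hr (hφ.comp measurable_prodMk_left)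
          ENNReal.ofReal_ne_top (fun t => hφm _)
    _ = _ := by
        rw [lintegral_const_mul' _ _ ENNReal.ofReal_ne_top, ← mul_assoc (ENNReal.ofReal C),
          ← ENNReal.ofReal_mul hC0.le, Measure.volume_eq_prod,
          lintegral_prod _ (hφ.pow_const r).aemeasurable]

lemma exists_lintegral_windowSum_gradScale_rpow_le (hd : 1 ≤ d) {p : ℝ} (hp : 2 ≤ p) :
    ∃ N : ℝ, 0 < N ∧ ∀ (V : Type) [NormedAddCommGroup V] [InnerProductSpace ℝ V] [CompleteSpace V]
      (f : ℝ × EuclideanSpace ℝ (Fin d) → V), ContDiff ℝ 1 f → HasCompactSupport f →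
      ∫⁻ z, windowSum (gradScale f) z ^ (p / 2) ≤
        ENNReal.ofReal N * ∫⁻ s, ∫⁻ x, ENNReal.ofReal (‖f (s, x)‖ ^ p) := by
  rcases hp.eq_or_lt with rfl | hp
  · simpa using exists_lintegral_windowSum_gradScale_le hd
  · have h := exists_lintegral_windowSum_gradScale_rpow_le_of_one_lt hd
      (show 1 < p / 2 by linarith)
    rwa [mul_div_cancel₀ p two_ne_zero] at h

end SquareFunction

/-- Hilbert-space valued Littlewood–Paley inequality: for `p ∈ [2,∞)`
there is a constant `N = N(d,p)` such that for every separable Hilbert space `V`,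
every `-∞ ≤ a < b ≤ ∞`, and every smooth compactly supported
`f : (a,b) × ℝ^d → V`,
`∫_{ℝ^d} ∫_a^b [∫_a^t ‖∇T_{t-s} f(s,·)(x)‖² ds]^{p/2} dt dx
   ≤ N ∫_{ℝ^d} ∫_a^b ‖f(t,x)‖^p dt dx`. -/
theorem littlewood_paley_hilbert (d : ℕ) (hd : 1 ≤ d) (p : ℝ) (hp : 2 ≤ p) :
    ∃ N : ℝ, 0 < N ∧
      ∀ (V : Type) [NormedAddCommGroup V] [InnerProductSpace ℝ V] [CompleteSpace V]
        [TopologicalSpace.SeparableSpace V]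
        (a b : EReal), a < b →
      ∀ (f : ℝ × EuclideanSpace ℝ (Fin d) → V),
        ContDiff ℝ (⊤ : ℕ∞) f → HasCompactSupport f →
        tsupport f ⊆ {q : ℝ × EuclideanSpace ℝ (Fin d) |
          a < (q.1 : EReal) ∧ (q.1 : EReal) < b} →
        (∫⁻ x : EuclideanSpace ℝ (Fin d),
            ∫⁻ t in {t : ℝ | a < (t : EReal) ∧ (t : EReal) < b},
              (∫⁻ s in {s : ℝ | a < (s : EReal) ∧ s < t},
                ENNReal.ofReal (gradHeatNormSq d (t - s) (fun y => f (s, y)) x)) ^ (p/2))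
          ≤ ENNReal.ofReal N *
            ∫⁻ x : EuclideanSpace ℝ (Fin d),
              ∫⁻ t in {t : ℝ | a < (t : EReal) ∧ (t : EReal) < b},
                ENNReal.ofReal (‖f (t, x)‖ ^ p) := by
  obtain ⟨N, hN, h⟩ := exists_lintegral_windowSum_gradScale_rpow_le hd hp
  have hp0 : 0 < p := by linarith
  refine ⟨(3 ^ ((d : ℝ)/2)) ^ (p/2) * N, by positivity, ?_⟩
  intro V _ _ _ _ a b _ f hf hfc hfs
  have hf1 : ContDiff ℝ 1 f := hf.of_le (by exact_mod_cast le_top)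
  have hfm : Measurable fun z => ENNReal.ofReal (‖f z‖ ^ p) :=
    (hf.continuous.norm.rpow_const fun _ => Or.inr hp0.le).measurable.ennreal_ofReal
  have hQ := measurable_windowSum (measurable_gradScale hf1 hfc)
  have hR : ∀ x, ∫⁻ t in {t : ℝ | a < (t : EReal) ∧ (t : EReal) < b},
      ENNReal.ofReal (‖f (t, x)‖ ^ p) = ∫⁻ t, ENNReal.ofReal (‖f (t, x)‖ ^ p) := by
    intro x
    refine setLIntegral_eq_of_support_subset ?_
    intro t ht
    have : f (t, x) ≠ 0 := by
      intro h0
      simp [h0, Real.zero_rpow hp0.ne'] at ht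
    exact hfs (subset_tsupport f this)
  simp_rw [hR]
  calc _ ≤ ∫⁻ x, ∫⁻ t, ENNReal.ofReal ((3 ^ ((d : ℝ)/2)) ^ (p/2)) *
          windowSum (gradScale f) (x, t) ^ (p/2) := by
        refine lintegral_mono fun x => ?_
        refine (setLIntegral_le_lintegral _ _).trans (lintegral_mono fun t => ?_)
        rw [← ENNReal.ofReal_rpow_of_nonneg (by positivity) (by positivity),
          ← ENNReal.mul_rpow_of_nonneg _ _ (by positivity : 0 ≤ p / 2)]
        gcongr
        exact lintegral_gradHeatNormSq_le hf1 hfc _ t (fun s hs => hs.2) x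
    _ = ENNReal.ofReal ((3 ^ ((d : ℝ)/2)) ^ (p/2)) *
          ∫⁻ z, windowSum (gradScale f) z ^ (p/2) := by
        simp_rw [lintegral_const_mul' _ _ ENNReal.ofReal_ne_top]
        rw [Measure.volume_eq_prod, lintegral_prod _ (hQ.pow_const _).aemeasurable]
    _ ≤ ENNReal.ofReal ((3 ^ ((d : ℝ)/2)) ^ (p/2)) * (ENNReal.ofReal N *
          ∫⁻ s, ∫⁻ x, ENNReal.ofReal (‖f (s, x)‖ ^ p)) := by
        gcongr
        exact h V f hf1 hfc
    _ = _ := by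
        rw [← mul_assoc, ← ENNReal.ofReal_mul (by positivity)]
        congr 1
        exact lintegral_lintegral_swap hfm.aemeasurable
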